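/- arXiv:2008.08503 — 4 statements merged into one kernel-verified Lean document; each statement's English description precedes it below -/
import Mathlib

section
/- Equality case of the Delsarte–Hoffman (ratio) bound: Let X be a finite simple graph, let A be a weighted adjacency matrix of X such that every row of A sums to the same real number d, and let τ be the least eigenvalue of A; assume τ < 0. If S is an independent set of X with |S| = |V(X)| / (1 − d/τ), then the vector χ_S − (|S|/|V(X)|)·𝟙 (where χ_S is the 0/1 characteristic vector of S and 𝟙 is the all-ones vector) satisfies A·(χ_S − (|S|/|V(X)|)𝟙) = τ·(χ_S − (|S|/|V(X)|)𝟙). -/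
open Matrix

/-- Subtracting a lower bound for the eigenvalues of a real symmetric matrix from its diagonal
leaves a positive semidefinite matrix. -/
theorem posSemidef_sub_smul_one_of_forall_le {V : Type*} [Fintype V] [DecidableEq V]
    {A : Matrix V V ℝ} (hA : A.IsSymm) {τ : ℝ}
    (hτ : ∀ (μ : ℝ) (x : V → ℝ), x ≠ 0 → A *ᵥ x = μ • x → τ ≤ μ) :
    (A - τ • (1 : Matrix V V ℝ)).PosSemidef := by
  have hM : (A - τ • (1 : Matrix V V ℝ)).IsHermitian := by
    rw [IsHermitian, conjTranspose_eq_transpose_of_trivial, transpose_sub, hA.eq, transpose_smul,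
      transpose_one]
  rw [hM.posSemidef_iff_eigenvalues_nonneg]
  intro i
  have h := hM.mulVec_eigenvectorBasis i
  rw [sub_mulVec, smul_mulVec, one_mulVec, sub_eq_iff_eq_add, ← add_smul] at h
  have hne : (hM.eigenvectorBasis i).ofLp ≠ 0 := fun h0 =>
    hM.eigenvectorBasis.toBasis.ne_zero i (by simpa using h0)
  have hle := hτ _ _ hne h
  simpa using hle

/-- **Equality case of the Delsarte–Hoffman (ratio) bound.**  Let `G` be a finite simple graph
and `A` a weighted adjacency matrix of `G` (real, symmetric, vanishing on non-adjacent pairs,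
in particular on the diagonal), all of whose rows sum to the same real number `d`, and let
`τ < 0` be the least eigenvalue of `A`.  If `S` is an independent set of `G` with
`|S| = |V(G)| / (1 - d / τ)`, then `χ_S - (|S| / |V(G)|) • 𝟙` is a `τ`-eigenvector of `A`. -/
theorem delsarte_hoffman_equality {V : Type*} [Fintype V] [DecidableEq V] (G : SimpleGraph V)
    (A : Matrix V V ℝ) (hsymm : A.IsSymm)
    (hzero : ∀ u v : V, ¬ G.Adj u v → A u v = 0)
    (d : ℝ) (hrow : ∀ u : V, ∑ v : V, A u v = d)
    (τ : ℝ) (hτneg : τ < 0)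
    (hτeig : ∃ x : V → ℝ, x ≠ 0 ∧ A.mulVec x = τ • x)
    (hτmin : ∀ (μ : ℝ) (x : V → ℝ), x ≠ 0 → A.mulVec x = μ • x → τ ≤ μ)
    (S : Finset V) (hS : ∀ u ∈ S, ∀ v ∈ S, ¬ G.Adj u v)
    (hcard : (S.card : ℝ) = (Fintype.card V : ℝ) / (1 - d / τ)) :
    A.mulVec (fun v => (if v ∈ S then (1 : ℝ) else 0) - (S.card : ℝ) / (Fintype.card V : ℝ)) =
      τ • (fun v => (if v ∈ S then (1 : ℝ) else 0) - (S.card : ℝ) / (Fintype.card V : ℝ)) := by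
  rcases isEmpty_or_nonempty V with hV | hV
  · exact Subsingleton.elim _ _
  have hn : (Fintype.card V : ℝ) ≠ 0 := Nat.cast_ne_zero.mpr Fintype.card_ne_zero
  have hτ0 : τ ≠ 0 := hτneg.ne
  set n : ℝ := (Fintype.card V : ℝ)
  set s : ℝ := (S.card : ℝ)
  have hsn : s * (s * (τ - d)) = s * (τ * n) := by
    by_cases hdτ : 1 - d / τ = 0
    · simp [hcard, hdτ]
    · rw [eq_div_iff hdτ] at hcard
      rw [← hcard]
      field_simp
  let χ : V → ℝ := fun v => if v ∈ S then 1 else 0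
  change A *ᵥ (fun v => χ v - s / n) = τ • (fun v => χ v - s / n)
  have hy : (fun v => χ v - s / n) = χ - (s / n) • (1 : V → ℝ) := by
    ext v
    simp
  rw [hy]
  have hA1 : A *ᵥ (1 : V → ℝ) = d • (1 : V → ℝ) := by
    ext u
    simp [mulVec, dotProduct, hrow]
  have hχ1 : χ ⬝ᵥ 1 = s := by simp [χ, s, dotProduct]
  have h1χ : 1 ⬝ᵥ χ = s := by rw [dotProduct_comm, hχ1]
  have h11 : (1 : V → ℝ) ⬝ᵥ 1 = n := by simp [n, dotProduct]
  have hχχ : χ ⬝ᵥ χ = s := by simp [χ, s, dotProduct]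
  have hχAχ : χ ⬝ᵥ A *ᵥ χ = 0 := by
    refine Finset.sum_eq_zero fun u _ => ?_
    by_cases hu : u ∈ S
    · refine mul_eq_zero_of_right _ (Finset.sum_eq_zero fun v _ => ?_)
      by_cases hv : v ∈ S
      · simp [hzero u v (hS u hu v hv)]
      · simp [χ, hv]
    · simp [χ, hu]
  have h1Aχ : 1 ⬝ᵥ A *ᵥ χ = d * s := by
    rw [dotProduct_mulVec, ← mulVec_transpose, hsymm.eq, hA1, smul_dotProduct, h1χ, smul_eq_mul]
  have hM := posSemidef_sub_smul_one_of_forall_le hsymm hτmin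
  have hzeroForm := (hM.dotProduct_mulVec_zero_iff (χ - (s / n) • (1 : V → ℝ))).mp (by
    simp only [star_trivial, sub_mulVec, smul_mulVec, one_mulVec, mulVec_sub, mulVec_smul, hA1,
      dotProduct_sub, sub_dotProduct, dotProduct_smul, smul_dotProduct, hχ1, h1χ, h11, hχχ, hχAχ,
      h1Aχ, smul_eq_mul]
    field_simp
    linear_combination hsn)
  rwa [sub_mulVec, smul_mulVec, one_mulVec, sub_eq_zero] at hzeroForm
end

section
/- Clique–coclique bound: If X is a finite vertex-transitive simple graph (for every pair of vertices u, v there is a graph automorphism of X sending u to v), then α(X) · ω(X) ≤ |V(X)|, where α(X) is the maximum size of an independent set of X and ω(X) is the maximum size of a clique of X. -/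
namespace SimpleGraph

variable {V : Type*} {G : SimpleGraph V}

open Classical in
/-- In a vertex-transitive graph, the number of automorphisms sending `u` to `v` does not depend
on `u` and `v`. -/
theorem card_automorphisms_sending_eq [Fintype (G ≃g G)]
    (hvt : ∀ u v : V, ∃ φ : G ≃g G, φ u = v) (u v u' v' : V) :
    Fintype.card {φ : G ≃g G // φ u = v} = Fintype.card {φ : G ≃g G // φ u' = v'} := by
  obtain ⟨a, ha⟩ := hvt u u'
  obtain ⟨b, hb⟩ := hvt v v'
  refine Fintype.card_congr (Equiv.subtypeEquiv
    ((Equiv.mulLeft b).trans (Equiv.mulRight a⁻¹)) fun φ => ?_)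
  have ha' : a⁻¹ u' = u := by rw [← ha]; exact a.symm_apply_apply u
  simp only [Equiv.trans_apply, Equiv.coe_mulLeft, Equiv.coe_mulRight, RelIso.mul_apply, ha']
  rw [← hb, b.injective.eq_iff]

open Classical in
/-- An automorphism maps at most one vertex of a given independent set into a given clique. -/
theorem card_filter_apply_eq_le_one {S C : Finset V}
    (hS : ∀ u ∈ S, ∀ v ∈ S, ¬ G.Adj u v) (hC : ∀ u ∈ C, ∀ v ∈ C, u ≠ v → G.Adj u v)
    (φ : G ≃g G) : ((S ×ˢ C).filter fun p => φ p.1 = p.2).card ≤ 1 := by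
  rw [Finset.card_le_one]
  rintro ⟨s, c⟩ h ⟨s', c'⟩ h'
  simp only [Finset.mem_filter, Finset.mem_product] at h h'
  obtain ⟨⟨hs, hc⟩, rfl⟩ := h
  obtain ⟨⟨hs', hc'⟩, rfl⟩ := h'
  by_cases heq : φ s = φ s'
  · rw [Prod.mk.injEq]
    exact ⟨φ.injective heq, heq⟩
  · exact absurd (φ.map_adj_iff.mp (hC _ hc _ hc' heq)) (hS s hs s' hs')

end SimpleGraph

/-- **Clique–coclique bound.**  If `G` is a finite vertex-transitive simple graph, then
`α(G) · ω(G) ≤ |V(G)|`: for every independent set `S` and every clique `C` of `G` one has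
`|S| · |C| ≤ |V(G)|` (equivalently, the product of the independence number and the clique
number is at most the number of vertices). -/
theorem clique_coclique_bound {V : Type*} [Fintype V] (G : SimpleGraph V)
    (hvt : ∀ u v : V, ∃ φ : G ≃g G, φ u = v)
    (S : Finset V) (hS : ∀ u ∈ S, ∀ v ∈ S, ¬ G.Adj u v)
    (C : Finset V) (hC : ∀ u ∈ C, ∀ v ∈ C, u ≠ v → G.Adj u v) :
    S.card * C.card ≤ Fintype.card V := by
  classical
  obtain rfl | ⟨u₀, -⟩ := S.eq_empty_or_nonempty
  · simp
  have : Finite (G ≃g G) := DFunLike.finite _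
  have : Fintype (G ≃g G) := Fintype.ofFinite _
  set m := Fintype.card {φ : G ≃g G // φ u₀ = u₀} with hm
  have hfiber (u v : V) : ((Finset.univ : Finset (G ≃g G)).filter fun φ => φ u = v).card = m := by
    rw [← Fintype.card_subtype, hm]
    exact SimpleGraph.card_automorphisms_sending_eq hvt u v u₀ u₀
  have hm_pos : 0 < m := Fintype.card_pos_iff.mpr ⟨⟨1, rfl⟩⟩
  have htotal : Fintype.card (G ≃g G) = Fintype.card V * m := by
    rw [← Finset.card_univ, Finset.card_eq_sum_card_fiberwise (f := fun φ : G ≃g G => φ u₀)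
      (t := Finset.univ) (by simp)]
    simp [hfiber]
  refine Nat.le_of_mul_le_mul_right ?_ hm_pos
  calc S.card * C.card * m
      = ∑ p ∈ S ×ˢ C, ((Finset.univ : Finset (G ≃g G)).filter fun φ => φ p.1 = p.2).card := by
        simp [hfiber]
    _ = ∑ φ : G ≃g G, ((S ×ˢ C).filter fun p => φ p.1 = p.2).card :=
        Finset.sum_card_bipartiteAbove_eq_sum_card_bipartiteBelow
          (fun (p : V × V) (φ : G ≃g G) => φ p.1 = p.2)
    _ ≤ ∑ _φ : G ≃g G, 1 :=
        Finset.sum_le_sum fun φ _ => SimpleGraph.card_filter_apply_eq_le_one hS hC φ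
    _ = Fintype.card V * m := by simp [← htotal]
end

section
/- If a ≥ 1 is an integer and 2k = 2^a + 2, then the clique number of the perfect matching derangement graph M_2(2k) equals (2k−1)(2k−3); that is, there exists a family of (2k−1)(2k−3) perfect matchings of K_{2k} any two of which have at most one edge in common, and no larger such family exists. -/
/-- A perfect matching of the complete graph on `Fin n`: a finite set of non-loop edges such
that every vertex lies on exactly one of them. -/
def IsPM {n : ℕ} (P : Finset (Sym2 (Fin n))) : Prop :=
  (∀ e ∈ P, ¬ e.IsDiag) ∧ ∀ v : Fin n, ∃! e, e ∈ P ∧ v ∈ e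

instance {n : ℕ} : DecidablePred (IsPM (n := n)) := fun _ => by
  unfold IsPM ExistsUnique; infer_instance

/-- The type of perfect matchings of the complete graph `K_n` on `Fin n`. -/
abbrev PM (n : ℕ) := {P : Finset (Sym2 (Fin n)) // IsPM P}

namespace IsPM

variable {n : ℕ} {P : Finset (Sym2 (Fin n))}

theorem exists_partner (hP : IsPM P) (v : Fin n) : ∃ w, w ≠ v ∧ s(v, w) ∈ P := by
  obtain ⟨e, ⟨he, hv⟩, -⟩ := hP.2 v
  obtain ⟨w, rfl⟩ := Sym2.mem_iff_exists.1 hv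
  exact ⟨w, fun h => hP.1 _ he (by simp [h]), he⟩

theorem eq_of_mem (hP : IsPM P) {u v w : Fin n} (hv : s(u, v) ∈ P) (hw : s(u, w) ∈ P) :
    v = w :=
  Sym2.congr_right.1
    ((hP.2 u).unique ⟨hv, Sym2.mem_mk_left u v⟩ ⟨hw, Sym2.mem_mk_left u w⟩)

end IsPM

/-- The partner of `v` in the perfect matching `P`. -/
noncomputable def PM.partner {n : ℕ} (P : PM n) (v : Fin n) : Fin n :=
  (P.2.exists_partner v).choose

namespace PM

variable {n : ℕ}

theorem partner_ne (P : PM n) (v : Fin n) : P.partner v ≠ v :=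
  (P.2.exists_partner v).choose_spec.1

theorem mk_partner_mem (P : PM n) (v : Fin n) : s(v, P.partner v) ∈ P.1 :=
  (P.2.exists_partner v).choose_spec.2

theorem partner_ne_of_ne (P : PM n) {u v : Fin n} (h : v ≠ P.partner u) :
    P.partner v ≠ u := by
  intro hv
  have h1 := P.mk_partner_mem v
  rw [hv, Sym2.eq_swap] at h1
  exact h (P.2.eq_of_mem h1 (P.mk_partner_mem u))

theorem partner_ne_partner (P : PM n) {u v : Fin n} (huv : v ≠ u) :
    P.partner v ≠ P.partner u := by
  intro h
  have h1 := P.mk_partner_mem v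
  have h2 := P.mk_partner_mem u
  rw [h, Sym2.eq_swap] at h1
  rw [Sym2.eq_swap] at h2
  exact huv (P.2.eq_of_mem h1 h2)

theorem one_lt_card_inter (P Q : PM n) {u v : Fin n} (huv : v ≠ u) (h : v ≠ P.partner u)
    (hu : P.partner u = Q.partner u) (hv : P.partner v = Q.partner v) :
    1 < (P.1 ∩ Q.1).card := by
  refine Finset.one_lt_card.2 ⟨s(u, P.partner u), ?_, s(v, P.partner v), ?_, ?_⟩
  · exact Finset.mem_inter.2 ⟨P.mk_partner_mem u, hu ▸ Q.mk_partner_mem u⟩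
  · exact Finset.mem_inter.2 ⟨P.mk_partner_mem v, hv ▸ Q.mk_partner_mem v⟩
  · grind

theorem card_le_of_card_inter_le_one (hn : 3 ≤ n) (F : Finset (PM n))
    (hF : ∀ P ∈ F, ∀ Q ∈ F, P ≠ Q → (P.1 ∩ Q.1).card ≤ 1) :
    F.card ≤ (n - 1) * (n - 3) := by
  have : NeZero n := ⟨by omega⟩
  have hex : ∀ w : Fin n, ∃ v, v ≠ 0 ∧ v ≠ w := fun w => Fin.exists_ne_and_ne_of_two_lt 0 w hn
  choose v hv0 hvw using hex
  let T : Finset (Σ _ : Fin n, Fin n) :=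
    (Finset.univ.erase 0).sigma fun w => Finset.univ \ {0, w, v w}
  have hT : T.card = (n - 1) * (n - 3) := by
    rw [Finset.card_sigma, Finset.sum_const_nat (m := n - 3)]
    · simp
    · intro w hw
      rw [Finset.card_sdiff_of_subset (Finset.subset_univ _), Finset.card_univ, Fintype.card_fin,
        Finset.card_eq_three.2
          ⟨0, w, v w, (Finset.ne_of_mem_erase hw).symm, (hv0 w).symm, (hvw w).symm, rfl⟩]
  rw [← hT]
  refine Finset.card_le_card_of_injOn
    (fun P => ⟨P.partner 0, P.partner (v (P.partner 0))⟩) ?_ ?_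
  · intro P _
    simp only [T, Finset.coe_sigma, Set.mem_sigma_iff, Finset.mem_coe, Finset.mem_erase,
      Finset.mem_sdiff, Finset.mem_univ, Finset.mem_insert, Finset.mem_singleton, true_and,
      and_true, not_or]
    exact ⟨P.partner_ne 0, P.partner_ne_of_ne (hvw _), P.partner_ne_partner (hv0 _),
      P.partner_ne _⟩
  · intro P hP Q hQ h
    by_contra hne
    simp only [Sigma.mk.injEq, heq_eq_eq] at h
    have := P.one_lt_card_inter Q (hv0 _) (hvw _) h.1 (by rw [h.2, h.1])
    exact absurd (hF P hP Q hQ hne) (by omega)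

theorem one_lt_card (hn : 3 ≤ n) (P : PM n) : 1 < P.1.card := by
  have : NeZero n := ⟨by omega⟩
  obtain ⟨v, hv0, hv⟩ := Fin.exists_ne_and_ne_of_two_lt 0 (P.partner 0) hn
  simpa using P.one_lt_card_inter P hv0 hv rfl rfl

open Classical in
/-- The perfect matching whose edges are the pairs related by `R`. -/
noncomputable def ofRel (R : Fin n → Fin n → Prop) (hs : Std.Symm R) (hi : ∀ v, ¬ R v v)
    (hR : ∀ v, ∃! w, R v w) : PM n :=
  ⟨Finset.univ.filter (· ∈ Sym2.fromRel hs), by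
    refine ⟨fun e he => ?_, fun v => ?_⟩
    · induction e with | _ x y =>
      rw [Finset.mem_filter, Sym2.fromRel_prop] at he
      intro h
      rw [Sym2.mk_isDiag_iff] at h
      exact hi y (h ▸ he.2)
    · obtain ⟨w, hw, hu⟩ := hR v
      refine ⟨s(v, w), ⟨by simpa using hw, Sym2.mem_mk_left v w⟩, ?_⟩
      rintro e ⟨he, hve⟩
      obtain ⟨x, rfl⟩ := Sym2.mem_iff_exists.1 hve
      rw [Finset.mem_filter, Sym2.fromRel_prop] at he
      rw [hu x he.2]⟩

theorem mk_mem_ofRel {R : Fin n → Fin n → Prop} {hs : Std.Symm R} {hi : ∀ v, ¬ R v v}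
    {hR : ∀ v, ∃! w, R v w} {v w : Fin n} : s(v, w) ∈ (ofRel R hs hi hR).1 ↔ R v w := by
  simp [ofRel]

end PM

section Hyperoval

variable {F : Type*} [Field F]

/-- Let `F` be a finite field of characteristic two. The hyperoval of the projective plane over
`F` consists of the points `(1 : x : x²)`, of `(0 : 0 : 1)` and of `(0 : 1 : 0)`, which are encoded
as `some (some x)`, `none` and `some none`. The points off the hyperoval are `(0 : 1 : c)` and
`(1 : b : b² + c²)` with `c ≠ 0`, encoded as `(none, c)` and `(some b, c)`. Then `SecantRel p v w`
says that `v` and `w` are distinct points of the hyperoval collinear with `p`. -/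
def SecantRel : Option F × Fˣ → Option (Option F) → Option (Option F) → Prop
  | (none, c), some (some x), some (some y) => x + y = c
  | (none, _), none, some none => True
  | (none, _), some none, none => True
  | (some b, c), some (some x), some (some y) => x ≠ y ∧ (x + b) * (y + b) = c ^ 2
  | (some b, _), none, some (some x) => x = b
  | (some b, _), some (some x), none => x = b
  | (some b, c), some none, some (some x) => x = b + c
  | (some b, c), some (some x), some none => x = b + c
  | _, _, _ => False

namespace SecantRel

theorem symm (p : Option F × Fˣ) {v w : Option (Option F)} (h : SecantRel p v w) :
    SecantRel p w v := by
  obtain ⟨_ | b, c⟩ := p <;> rcases v with _ | _ | x <;> rcases w with _ | _ | y <;>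
    simp only [SecantRel] at h ⊢ <;> grind

variable [CharP F 2]

theorem irrefl (p : Option F × Fˣ) (v : Option (Option F)) : ¬ SecantRel p v v := by
  obtain ⟨_ | b, c⟩ := p <;> rcases v with _ | _ | x <;> simp [SecantRel, CharTwo.add_self_eq_zero]
  exact c.ne_zero.symm

theorem existsUnique (p : Option F × Fˣ) (v : Option (Option F)) : ∃! w, SecantRel p v w := by
  have h2 : (2 : F) = 0 := CharTwo.two_eq_zero
  obtain ⟨_ | b, c⟩ := p
  · rcases v with _ | _ | x
    · refine ⟨some none, by simp [SecantRel], ?_⟩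
      rintro (_ | _ | y) h <;> simp_all [SecantRel]
    · refine ⟨none, by simp [SecantRel], ?_⟩
      rintro (_ | _ | y) h <;> simp_all [SecantRel]
    · refine ⟨some (some (x + c)), by simp only [SecantRel]; grind, ?_⟩
      rintro (_ | _ | y) h <;> simp only [SecantRel] at h
      grind
  · have hc := c.ne_zero
    rcases v with _ | _ | x
    · refine ⟨some (some b), by simp [SecantRel], ?_⟩
      rintro (_ | _ | y) h <;> simp_all [SecantRel]
    · refine ⟨some (some (b + c)), by simp [SecantRel], ?_⟩
      rintro (_ | _ | y) h <;> simp_all [SecantRel]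
    · by_cases hb : x = b
      · refine ⟨none, by simp [SecantRel, hb], ?_⟩
        rintro (_ | _ | y) h <;> simp only [SecantRel] at h <;> grind
      by_cases hbc : x = b + c
      · refine ⟨some none, by simp [SecantRel, hbc], ?_⟩
        rintro (_ | _ | y) h <;> simp only [SecantRel] at h <;> grind
      have hxb : x + b ≠ 0 := fun h => hb (CharTwo.add_eq_zero.1 h)
      refine ⟨some (some (b + c ^ 2 / (x + b))), ?_, ?_⟩
      · refine ⟨fun h => ?_, by field_simp; grind⟩
        have : (x + b + c) ^ 2 = 0 := by field_simp at h; grind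
        have := pow_eq_zero_iff two_ne_zero |>.1 this
        grind
      · rintro (_ | _ | y) h <;> simp only [SecantRel] at h
        · grind
        · grind
        · obtain ⟨-, h⟩ := h
          congr 2
          field_simp
          grind

theorem eq_of_two_edges {p q : Option F × Fˣ} {v w v' w' : Option (Option F)}
    (hne : s(v, w) ≠ s(v', w')) (hp : SecantRel p v w) (hp' : SecantRel p v' w')
    (hq : SecantRel q v w) (hq' : SecantRel q v' w') : p = q := by
  have h2 : (2 : F) = 0 := CharTwo.two_eq_zero
  have pair_eq : ∀ {x y x' y' : F}, x + y = x' + y' → x * y = x' * y' →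
      x = x' ∧ y = y' ∨ x = y' ∧ y = x' := fun {x y x' y'} h h' => by
    have : (x - x') * (x - y') = 0 := by grind
    rcases mul_eq_zero.1 this with h0 | h0 <;> grind
  obtain ⟨_ | b, c⟩ := p <;> obtain ⟨_ | d, e⟩ := q <;>
    rcases v with _ | _ | x <;> rcases w with _ | _ | y <;> simp only [SecantRel] at hp hq <;>
    rcases v' with _ | _ | x' <;> rcases w' with _ | _ | y' <;>
    simp only [SecantRel] at hp' hq' <;>
    simp [Units.ext_iff] at hne ⊢
  case none.some.some.some.some.some.some.some.some.some =>
    have := @pair_eq x y x' y' (by grind) (by grind)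
    grind
  case some.none.some.some.some.some.some.some.some.some =>
    have := @pair_eq x y x' y' (by grind) (by grind)
    grind
  case some.some.some.some.some.some.some.some.some.some =>
    have hbd : b = d := by
      by_contra hbd
      have hadd : x + y = x' + y' := mul_left_cancel₀ (sub_ne_zero.2 hbd) (by grind)
      have := @pair_eq x y x' y' hadd (by grind)
      grind
    exact ⟨hbd, CharTwo.sq_injective (by grind)⟩
  all_goals grind

end SecantRel

end Hyperoval

theorem PM.exists_card_inter_le_one (F : Type*) [Field F] [Fintype F] [CharP F 2] (n : ℕ)
    (hn : n = Fintype.card F + 2) :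
    ∃ S : Finset (PM n), (∀ P ∈ S, ∀ Q ∈ S, P ≠ Q → (P.1 ∩ Q.1).card ≤ 1) ∧
      S.card = (n - 1) * (n - 3) := by
  classical
  let φ : Fin n ≃ Option (Option F) := Fintype.equivOfCardEq (by simp [hn])
  let f : Option F × Fˣ → PM n := fun p =>
    PM.ofRel (fun i j => SecantRel p (φ i) (φ j)) ⟨fun _ _ => SecantRel.symm p⟩
      (fun _ => SecantRel.irrefl p _)
      fun v => (φ.bijective.existsUnique_iff (p := fun w => SecantRel p (φ v) w)).1
        (SecantRel.existsUnique p (φ v))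
  have hf : ∀ p q, p ≠ q → ((f p).1 ∩ (f q).1).card ≤ 1 := by
    intro p q hpq
    refine Finset.card_le_one.2 fun e he e' he' => ?_
    by_contra hne
    induction e with | _ v w =>
    induction e' with | _ v' w' =>
    rw [Finset.mem_inter, PM.mk_mem_ofRel, PM.mk_mem_ofRel] at he he'
    refine hpq (SecantRel.eq_of_two_edges (fun h => hne ?_) he.1 he'.1 he.2 he'.2)
    simpa using h
  have hinj : Function.Injective f := by
    intro p q hpq
    by_contra hne
    have h1 := hf p q hne
    have h2 := PM.one_lt_card (by have := Fintype.one_lt_card (α := F); omega) (f p)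
    rw [← hpq, Finset.inter_self] at h1
    omega
  refine ⟨Finset.univ.image f, ?_, ?_⟩
  · simp only [Finset.mem_image, Finset.mem_univ, true_and]
    rintro _ ⟨p, rfl⟩ _ ⟨q, rfl⟩ hne
    exact hf p q fun h => hne (h ▸ rfl)
  · rw [Finset.card_image_of_injective _ hinj, Finset.card_univ, Fintype.card_prod,
      Fintype.card_option, Fintype.card_units, hn]
    rfl

/-- If `a ≥ 1` and `2k = 2^a + 2`, then the clique number of the perfect matching
derangement graph `M₂(2k)` equals `(2k-1)(2k-3)`: there is a family of `(2k-1)(2k-3)`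
perfect matchings of `K_{2k}` any two of which share at most one edge, and no larger such
family exists. -/
theorem cliqueNumber_M2 (a k : ℕ) (ha : 1 ≤ a) (hk : 2 * k = 2 ^ a + 2) :
    (∃ F : Finset (PM (2 * k)),
        (∀ P ∈ F, ∀ Q ∈ F, P ≠ Q → (P.1 ∩ Q.1).card ≤ 1) ∧
        F.card = (2 * k - 1) * (2 * k - 3)) ∧
    (∀ F : Finset (PM (2 * k)),
        (∀ P ∈ F, ∀ Q ∈ F, P ≠ Q → (P.1 ∩ Q.1).card ≤ 1) →
        F.card ≤ (2 * k - 1) * (2 * k - 3)) := by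
  have h3 : 3 ≤ 2 * k := by have := Nat.one_le_two_pow (n := a); omega
  refine ⟨?_, PM.card_le_of_card_inter_le_one h3⟩
  have : Fintype (GaloisField 2 a) := Fintype.ofFinite _
  refine PM.exists_card_inter_le_one (GaloisField 2 a) (2 * k) ?_
  rw [← Nat.card_eq_fintype_card, GaloisField.card 2 a (by omega), hk]
end

section
/- For every integer k with 3 ≤ k ≤ 9, there exists a real symmetric matrix M whose rows and columns are indexed by the perfect matchings of K_{2k}, with M(P,Q) = 0 whenever the perfect matchings P and Q have at least 2 edges in common (in particular all diagonal entries are 0), such that every row of M sums to (2k−1)(2k−3) − 1 and the least eigenvalue of M equals −1. -/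
/-- Digit `i` of `F` in base 32. A number codes a function on `{0, …, n - 1}` by its digits. -/
def ev (F i : ℕ) : ℕ := Nat.land (Nat.shiftRight F (Nat.mul 5 i)) 31

/-- Apply `f` to `x`; the recursion makes the kernel evaluate `x` first. -/
noncomputable def force {α : Type} (x : ℕ) (f : ℕ → α) : α :=
  Nat.rec (f 0) (fun p _ => f (Nat.succ p)) x

/-- The number with digits `f i`, for `i` in a list. -/
noncomputable def pack (l : List ℕ) (f : ℕ → ℕ) : ℕ :=
  List.rec 0 (fun i _ ih => Nat.add (f i) (Nat.mul 32 ih)) l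

noncomputable def allB {α : Type} (l : List α) (p : α → Bool) : Bool :=
  List.rec true (fun i _ ih => cond (p i) ih false) l

noncomputable def anyB {α : Type} (l : List α) (p : α → Bool) : Bool :=
  List.rec false (fun i _ ih => cond (p i) true ih) l

noncomputable def memB (x : ℕ) (l : List ℕ) : Bool := anyB l (Nat.beq x)

noncomputable def nodupB (l : List ℕ) : Bool :=
  List.rec true (fun a t ih => cond (memB a t) false ih) l

/-- The bitwise disjunction of the numbers `f i`, for `i` in a list. -/
noncomputable def orB (l : List ℕ) (f : ℕ → ℕ) : ℕ :=
  List.rec 0 (fun i _ ih => Nat.lor (f i) ih) l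

/-- Pass the evaluated list of all `g i` to `f`. -/
noncomputable def mapForce {α : Type} (g : ℕ → ℕ) (l : List ℕ) (f : List ℕ → α) : α :=
  List.rec (motive := fun _ => (List ℕ → α) → α) (fun f => f [])
    (fun i _ ih f => force (g i) fun x => ih fun t => f (x :: t)) l f

/-- `F` codes an involution without fixed points. -/
noncomputable def isInv (pos : List ℕ) (n F : ℕ) : Bool :=
  allB pos fun i => force (ev F i) fun x =>
    cond (Nat.ble n x) false (cond (Nat.beq x i) false (Nat.beq (ev F x) i))

/-- `g` codes a permutation with inverse `h`. -/
noncomputable def isPerm (pos : List ℕ) (n g h : ℕ) : Bool :=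
  allB pos fun i => force (ev g i) fun x => cond (Nat.ble n x) false (Nat.beq (ev h x) i)

/-- The conjugate of `F` by the permutation `g` with inverse `h`. -/
noncomputable def conjBy (pos : List ℕ) (g h F : ℕ) : ℕ := pack pos fun i => ev g (ev F (ev h i))

/-- The set of edges `{i, F i}`, one bit for each of them. -/
noncomputable def mask (pos : List ℕ) (F : ℕ) : ℕ :=
  orB pos fun i => force (ev F i) fun x =>
    cond (Nat.blt i x) (Nat.shiftLeft 1 (Nat.add (Nat.mul 32 i) x)) 0

/-- `x` has at most one binary digit equal to `1`. -/
def fewB (x : ℕ) : Bool := Nat.beq (Nat.land x (Nat.sub x 1)) 0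

/-- `S` codes a permutation carrying `A` to `F` and `T` to `G`. -/
noncomputable def isConj (pos : List ℕ) (n A T F G S : ℕ) : Bool :=
  cond (Nat.beq (orB pos fun p => Nat.shiftLeft 1 (ev S p)) (Nat.sub (Nat.pow 2 n) 1))
    (allB pos fun p => force (ev S p) fun s =>
      cond (Nat.beq (ev F s) (ev S (Nat.mod (ev A p) n)))
        (Nat.beq (ev G s) (ev S (Nat.mod (ev T p) n))) false) false

/-- Follow the cycle of `F` and `G` through `i`, collecting its length, its vertices, and the set
of all visited vertices. -/
noncomputable def cycleFrom (F G i : ℕ) (f : ℕ → ℕ → ℕ → Bool) (fuel : List ℕ) :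
    ℕ → ℕ → ℕ → ℕ → Bool :=
  List.rec (motive := fun _ => ℕ → ℕ → ℕ → ℕ → Bool) (fun _ _ _ _ => false)
    (fun _ _ ih a len seq vis =>
      force (ev F a) fun b => force (ev G b) fun c =>
      force (Nat.succ len) fun len =>
      force (Nat.add (Nat.add a (Nat.mul 32 b)) (Nat.mul 1024 seq)) fun seq =>
      force (Nat.lor vis (Nat.lor (Nat.shiftLeft 1 a) (Nat.shiftLeft 1 b))) fun vis =>
      cond (Nat.beq c i) (f len seq vis) (ih c len seq vis)) fuel

/-- Insert a cycle in a list of cycles sorted by length. -/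
noncomputable def insertCycle (len seq : ℕ) (l : List (ℕ × ℕ)) (f : List (ℕ × ℕ) → Bool) : Bool :=
  List.rec (motive := fun _ => (List (ℕ × ℕ) → Bool) → Bool) (fun f => f [(len, seq)])
    (fun a t ih f => cond (Nat.ble len a.1) (f ((len, seq) :: a :: t)) (ih fun t => f (a :: t))) l f

/-- The sorted list of all cycles of `F` and `G`. -/
noncomputable def cycles (pos : List ℕ) (F G : ℕ) (f : List (ℕ × ℕ) → Bool) (todo : List ℕ) :
    ℕ → List (ℕ × ℕ) → Bool :=
  List.rec (motive := fun _ => ℕ → List (ℕ × ℕ) → Bool) (fun _ l => f l)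
    (fun i _ ih vis l =>
      cond (Nat.beq (Nat.land (Nat.shiftRight vis i) 1) 1) (ih vis l)
        (cycleFrom F G i (fun len seq vis => insertCycle len seq l (ih vis)) pos i 0 0 vis)) todo

/-- Concatenate the cycles and their lengths. -/
noncomputable def flatten (f : ℕ → ℕ → Bool) (l : List (ℕ × ℕ)) : ℕ → ℕ → ℕ → ℕ → Bool :=
  List.rec (motive := fun _ => ℕ → ℕ → ℕ → ℕ → Bool) (fun s key _ _ => f s key)
    (fun a _ ih s key i j =>
      force (Nat.add s (Nat.shiftLeft a.2 (Nat.mul 10 i))) fun s =>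
      force (Nat.add key (Nat.shiftLeft a.1 (Nat.mul 5 j))) fun key =>
      force (Nat.add i a.1) fun i => ih s key i (Nat.succ j)) l

/-- Pass to `f` a permutation bringing `F` and `G` to normal form, and their cycle lengths. -/
noncomputable def canon (pos : List ℕ) (F G : ℕ) (f : ℕ → ℕ → Bool) : Bool :=
  cycles pos F G (fun l => flatten f l 0 0 0 0) pos 0 []

/-- For each cycle type, its key, its normal form, and the positive and the negative weights. -/
inductive Tally
  | nil
  | cons (key T p m : ℕ) (tl : Tally)

noncomputable def Tally.add (chk : ℕ → Bool) (key wp wn : ℕ) (acc : Tally)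
    (f : Tally → Bool) : Bool :=
  Tally.rec (motive := fun _ => (Tally → Bool) → Bool) (fun _ => false)
    (fun key' T p m tl ih f => cond (Nat.beq key key')
      (cond (chk T) (force (Nat.add p wp) fun p => force (Nat.add m wn) fun m =>
        f (Tally.cons key' T p m tl)) false)
      (ih fun tl => f (Tally.cons key' T p m tl))) acc f

noncomputable def Tally.init (l : List (ℕ × ℕ)) : Tally :=
  List.rec Tally.nil (fun a _ ih => Tally.cons a.1 a.2 0 0 ih) l

noncomputable def Tally.isZero (t : Tally) : Bool :=
  Tally.rec true (fun _ _ p m _ ih => cond (Nat.beq p m) ih false) t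

/-- Add the contributions of the pairs formed by `F` and the members of a list. -/
noncomputable def tallyRow (pos : List ℕ) (n A F MF wp wn : ℕ) (l : List (ℕ × ℕ)) :
    Tally → (Tally → Bool) → Bool :=
  List.rec (motive := fun _ => Tally → (Tally → Bool) → Bool) (fun acc f => f acc)
    (fun a _ ih acc f => cond (fewB (Nat.land MF a.2)) (ih acc f)
      (canon pos F a.1 fun S key =>
        Tally.add (fun T => isConj pos n A T F a.1 S) key wp wn acc fun acc => ih acc f)) l

/-- The weighted inner product `∑ s_t * u_t * v_t`. -/
noncomputable def dot (s : List ℕ) : List ℤ → List ℤ → ℤ :=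
  List.rec (motive := fun _ => List ℤ → List ℤ → ℤ) (fun _ _ => 0)
    (fun a _ ih u v => List.rec 0 (fun x u' _ => List.rec 0 (fun y v' _ =>
      Int.add (Int.mul (Int.ofNat a) (Int.mul x y)) (ih u' v')) v) u) s

noncomputable def sumZ {α : Type} (l : List α) (f : α → ℤ) : ℤ :=
  List.rec 0 (fun a _ ih => Int.add (f a) ih) l

/-- Pass the positive and the negative part of `z` to `f`. -/
noncomputable def forceZ {α : Type} (z : ℤ) (f : ℕ → ℕ → α) : α :=
  Int.rec (fun a => force a fun a => f a 0) (fun a => force (Nat.succ a) fun a => f 0 a) z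

noncomputable def withMasks {α : Type} (pos : List ℕ) (l : List ℕ)
    (f : List (ℕ × ℕ) → α) : α :=
  List.rec (motive := fun _ => (List (ℕ × ℕ) → α) → α) (fun f => f [])
    (fun F _ ih f => force F fun F => force (mask pos F) fun m => ih fun t => f ((F, m) :: t)) l f

noncomputable def classesWithMasks {α : Type} (pos : List ℕ) (l : List (List ℤ × List ℕ))
    (f : List (List ℤ × List (ℕ × ℕ)) → α) : α :=
  List.rec (motive := fun _ => (List (List ℤ × List (ℕ × ℕ)) → α) → α) (fun f => f [])
    (fun c _ ih f => withMasks pos c.2 fun m => ih fun t => f ((c.1, m) :: t)) l f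

/-- Add the contributions of `len` copies of `F`, with weights `u`, and all members of the
classes. -/
noncomputable def tallyHead (pos : List ℕ) (n A : ℕ) (s : List ℕ) (u : List ℤ) (len F MF : ℕ)
    (cs : List (List ℤ × List (ℕ × ℕ))) : Tally → (Tally → Bool) → Bool :=
  List.rec (motive := fun _ => Tally → (Tally → Bool) → Bool) (fun acc f => f acc)
    (fun c _ ih acc f => forceZ (Int.mul (Int.ofNat len) (dot s u c.1)) fun wp wn =>
      tallyRow pos n A F MF wp wn c.2 acc fun acc => ih acc f) cs

noncomputable def tallyAll (pos : List ℕ) (n A : ℕ) (s : List ℕ)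
    (cs todo : List (List ℤ × List (ℕ × ℕ))) : Tally → (Tally → Bool) → Bool :=
  List.rec (motive := fun _ => Tally → (Tally → Bool) → Bool) (fun acc f => f acc)
    (fun c _ ih acc f => List.rec false (fun a t _ =>
      tallyHead pos n A s c.1 (List.length (a :: t)) a.1 a.2 cs acc fun acc => ih acc f) c.2) todo

/-- Every member of the list after the first is a conjugate of the preceding one, or conversely. -/
noncomputable def linked (pos : List ℕ) (gens : List (ℕ × ℕ)) (l : List ℕ) : ℕ → Bool :=
  List.rec (motive := fun _ => ℕ → Bool) (fun _ => true)
    (fun b _ ih a => cond (anyB gens fun g => cond (Nat.beq (conjBy pos g.1 g.2 a) b) true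
      (Nat.beq (conjBy pos g.1 g.2 b) a)) (ih b) false) l

/-- The list is contained in all its conjugates by generators. -/
noncomputable def closedB (pos : List ℕ) (gens : List (ℕ × ℕ)) (l : List ℕ) : Bool :=
  allB gens fun g => mapForce (conjBy pos g.1 g.2) l fun m => allB l fun x => memB x m

/-- A union of orbits (`classes`) of perfect matchings under the group generated by `gens`, each
with a vector of weights. -/
structure Cert where
  n : ℕ
  pos : List ℕ
  base : ℕ
  scale : List ℕ
  types : List (ℕ × ℕ)
  gens : List (ℕ × ℕ)
  classes : List (List ℤ × List ℕ)

noncomputable def Cert.total (C : Cert) : ℤ :=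
  sumZ C.classes fun c => sumZ C.classes fun c' =>
    Int.mul (Int.mul (Int.ofNat c.2.length) (Int.ofNat c'.2.length)) (dot C.scale c.1 c'.1)

noncomputable def Cert.checkOrbits (C : Cert) : Bool :=
  cond (isInv C.pos C.n C.base) (cond (allB C.gens fun g => isPerm C.pos C.n g.1 g.2)
    (allB C.classes fun c => cond (allB c.2 (isInv C.pos C.n)) (cond (nodupB c.2)
      (cond (closedB C.pos C.gens c.2)
        (List.rec false (fun a t _ => linked C.pos C.gens t a) c.2) false) false) false) false) false

noncomputable def Cert.checkPairs (C : Cert) : Bool :=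
  classesWithMasks C.pos C.classes fun cs =>
    tallyAll C.pos C.n C.base C.scale cs cs (Tally.init C.types) fun acc =>
      Tally.rec false (fun _ T p m tl _ => cond (Nat.beq T C.base) (cond (Nat.blt m p)
        (cond tl.isZero (force (Nat.mul (Nat.sub C.n 1) (Nat.sub C.n 3)) fun r =>
          Nat.beq (Nat.mul r p) (Nat.add (Nat.mul r m) (Int.toNat C.total))) false) false) false) acc

section Spec

variable {α : Type}

@[simp]
theorem force_eq (x : ℕ) (f : ℕ → α) : force x f = f x := by
  cases x <;> rfl

theorem allB_iff {l : List α} {p : α → Bool} : allB l p = true ↔ ∀ a ∈ l, p a = true := by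
  induction l with
  | nil => simp [allB]
  | cons a l ih =>
    have h : allB (a :: l) p = cond (p a) (allB l p) false := rfl
    rw [h]
    cases hp : p a <;> simp [hp, ih]

theorem anyB_iff {l : List α} {p : α → Bool} : anyB l p = true ↔ ∃ a ∈ l, p a = true := by
  induction l with
  | nil => simp [anyB]
  | cons a l ih =>
    have h : anyB (a :: l) p = cond (p a) true (anyB l p) := rfl
    rw [h]
    cases hp : p a <;> simp [hp, ih]

theorem memB_iff {x : ℕ} {l : List ℕ} : memB x l = true ↔ x ∈ l := by
  simp [memB, anyB_iff]

theorem nodupB_iff {l : List ℕ} : nodupB l = true ↔ l.Nodup := by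
  induction l with
  | nil => simp [nodupB]
  | cons a l ih =>
    have h : nodupB (a :: l) = cond (memB a l) false (nodupB l) := rfl
    rw [h, List.nodup_cons, ← memB_iff, ← ih]
    cases memB a l <;> simp

theorem testBit_orB {l : List ℕ} {f : ℕ → ℕ} {b : ℕ} :
    (orB l f).testBit b = true ↔ ∃ i ∈ l, (f i).testBit b = true := by
  induction l with
  | nil => simp [orB]
  | cons a l ih =>
    have h : orB (a :: l) f = f a ||| orB l f := rfl
    rw [h, Nat.testBit_or, Bool.or_eq_true, ih]
    simp

theorem ev_eq (F i : ℕ) : ev F i = F / 2 ^ (5 * i) % 32 := by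
  have h : ev F i = (F >>> (5 * i)) &&& 31 := rfl
  rw [h, Nat.shiftRight_eq_div_pow]
  exact Nat.and_two_pow_sub_one_eq_mod _ 5

theorem ev_pack {l : List ℕ} {f : ℕ → ℕ} (hf : ∀ a ∈ l, f a < 32) {i : ℕ} (hi : i < l.length) :
    ev (pack l f) i = f l[i] := by
  induction l generalizing i with
  | nil => simp at hi
  | cons a l ih =>
    have h : pack (a :: l) f = f a + 32 * pack l f := rfl
    have ha := hf a (by simp)
    rw [h, ev_eq]
    cases i with
    | zero => simp; omega
    | succ i =>
      rw [Nat.mul_succ, Nat.add_comm (5 * i), pow_add, ← Nat.div_div_eq_div_mul]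
      have h2 : (f a + 32 * pack l f) / 2 ^ 5 = pack l f := by omega
      rw [h2, ← ev_eq]
      simpa using ih (fun b hb => hf b (by simp [hb])) (by simpa using hi)

theorem mapForce_eq (g : ℕ → ℕ) (l : List ℕ) (f : List ℕ → α) :
    mapForce g l f = f (l.map g) := by
  induction l generalizing f with
  | nil => rfl
  | cons a l ih =>
    have h : mapForce g (a :: l) f =
      force (g a) fun x => mapForce g l fun t => f (x :: t) := rfl
    rw [h, force_eq, ih]
    rfl

theorem isInv_iff {pos : List ℕ} {n F : ℕ} : isInv pos n F = true ↔
    ∀ i ∈ pos, ev F i < n ∧ ev F i ≠ i ∧ ev F (ev F i) = i := by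
  refine allB_iff.trans (forall₂_congr fun i _ => ?_)
  rw [force_eq, Bool.cond_eq_ite, Bool.cond_eq_ite]
  by_cases h : n ≤ ev F i
  · simp [h]
  · by_cases h' : ev F i = i
    · simp [h']
    · simp [h', not_le.1 h]

theorem isPerm_iff {pos : List ℕ} {n g h : ℕ} : isPerm pos n g h = true ↔
    ∀ i ∈ pos, ev g i < n ∧ ev h (ev g i) = i := by
  refine allB_iff.trans (forall₂_congr fun i _ => ?_)
  rw [force_eq, Bool.cond_eq_ite]
  by_cases h' : n ≤ ev g i
  · simp [h']
  · simp [not_le.1 h']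

theorem isConj_eq_true_iff {pos : List ℕ} {n A T F G S : ℕ} : isConj pos n A T F G S = true ↔
    orB pos (fun p => 2 ^ ev S p) = 2 ^ n - 1 ∧
    ∀ p ∈ pos, ev F (ev S p) = ev S (ev A p % n) ∧ ev G (ev S p) = ev S (ev T p % n) := by
  have h : isConj pos n A T F G S =
    cond (Nat.beq (orB pos (fun p => 1 <<< ev S p)) (2 ^ n - 1))
    (allB pos fun p => force (ev S p) fun s =>
      cond (Nat.beq (ev F s) (ev S (ev A p % n)))
        (Nat.beq (ev G s) (ev S (ev T p % n))) false) false := rfl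
  simp only [h, Nat.one_shiftLeft, force_eq, Bool.cond_false_right, Bool.and_eq_true, allB_iff,
    Nat.beq_eq]

theorem insertCycle_spec {len seq : ℕ} {l : List (ℕ × ℕ)} {f : List (ℕ × ℕ) → Bool}
    (h : insertCycle len seq l f = true) : ∃ l', f l' = true := by
  induction l generalizing f with
  | nil => exact ⟨_, h⟩
  | cons a l ih =>
    change cond (Nat.ble len a.1) (f ((len, seq) :: a :: l))
      (insertCycle len seq l fun t => f (a :: t)) = true at h
    cases hb : Nat.ble len a.1
    · rw [hb] at h
      obtain ⟨l', h'⟩ := ih h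
      exact ⟨_, h'⟩
    · rw [hb] at h
      exact ⟨_, h⟩

theorem cycleFrom_spec {F G i : ℕ} {f : ℕ → ℕ → ℕ → Bool} {fuel : List ℕ} {a len seq vis : ℕ}
    (h : cycleFrom F G i f fuel a len seq vis = true) :
    ∃ len seq vis, f len seq vis = true := by
  induction fuel generalizing a len seq vis with
  | nil => cases h
  | cons _ l ih =>
    change (force (ev F a) fun b => force (ev G b) fun c =>
      force (Nat.succ len) fun len =>
      force (Nat.add (Nat.add a (Nat.mul 32 b)) (Nat.mul 1024 seq)) fun seq =>
      force (Nat.lor vis (Nat.lor (Nat.shiftLeft 1 a) (Nat.shiftLeft 1 b))) fun vis =>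
      cond (Nat.beq c i) (f len seq vis) (cycleFrom F G i f l c len seq vis)) = true at h
    simp only [force_eq] at h
    cases hb : Nat.beq (ev G (ev F a)) i
    · rw [hb] at h
      exact ih h
    · rw [hb] at h
      exact ⟨_, _, _, h⟩

theorem cycles_spec {pos todo : List ℕ} {F G : ℕ} {f : List (ℕ × ℕ) → Bool} {vis : ℕ}
    {l : List (ℕ × ℕ)} (h : cycles pos F G f todo vis l = true) : ∃ l, f l = true := by
  induction todo generalizing vis l with
  | nil => exact ⟨l, h⟩
  | cons i todo ih =>
    change cond (Nat.beq (Nat.land (Nat.shiftRight vis i) 1) 1) (cycles pos F G f todo vis l)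
        (cycleFrom F G i (fun len seq vis => insertCycle len seq l (cycles pos F G f todo vis))
          pos i 0 0 vis) = true at h
    cases hb : Nat.beq (Nat.land (Nat.shiftRight vis i) 1) 1
    · rw [hb] at h
      obtain ⟨_, _, _, h'⟩ := cycleFrom_spec h
      obtain ⟨_, h'⟩ := insertCycle_spec h'
      exact ih h'
    · rw [hb] at h
      exact ih h

theorem flatten_spec {f : ℕ → ℕ → Bool} {l : List (ℕ × ℕ)} {s key i j : ℕ}
    (h : flatten f l s key i j = true) : ∃ s key, f s key = true := by
  induction l generalizing s key i j with
  | nil => exact ⟨_, _, h⟩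
  | cons a l ih =>
    change (force (Nat.add s (Nat.shiftLeft a.2 (Nat.mul 10 i))) fun s =>
      force (Nat.add key (Nat.shiftLeft a.1 (Nat.mul 5 j))) fun key =>
      force (Nat.add i a.1) fun i => flatten f l s key i (Nat.succ j)) = true at h
    simp only [force_eq] at h
    exact ih h

theorem canon_spec {pos : List ℕ} {F G : ℕ} {f : ℕ → ℕ → Bool}
    (h : canon pos F G f = true) : ∃ S key, f S key = true := by
  obtain ⟨_, h⟩ := cycles_spec h
  exact flatten_spec h

/-- The combination of the values of `v` with the weights recorded in the tally. -/
def Tally.val (v : ℕ → ℤ) : Tally → ℤ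
  | nil => 0
  | cons _ T p m tl => (p - m) * v T + val v tl

theorem Tally.add_spec {chk : ℕ → Bool} {key wp wn : ℕ} {acc : Tally} {f : Tally → Bool}
    (h : Tally.add chk key wp wn acc f = true) :
    ∃ T acc', chk T = true ∧ f acc' = true ∧
      ∀ v, acc'.val v = acc.val v + ((wp : ℤ) - wn) * v T := by
  induction acc generalizing f with
  | nil => cases h
  | cons key' T p m tl ih =>
    change cond (Nat.beq key key')
      (cond (chk T) (force (Nat.add p wp) fun p => force (Nat.add m wn) fun m =>
        f (Tally.cons key' T p m tl)) false)
      (Tally.add chk key wp wn tl fun tl => f (Tally.cons key' T p m tl)) = true at h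
    simp only [force_eq] at h
    cases hb : Nat.beq key key'
    · rw [hb] at h
      obtain ⟨T', acc', h1, h2, h3⟩ := ih h
      exact ⟨T', _, h1, h2, fun v => by simp only [val, h3]; ring⟩
    · rw [hb] at h
      simp only [cond_true, Bool.cond_false_right, Bool.and_eq_true] at h
      refine ⟨T, _, h.1, h.2, fun v => ?_⟩
      simp only [val, Nat.add_eq, Nat.cast_add]
      ring

theorem Tally.val_init (v : ℕ → ℤ) (l : List (ℕ × ℕ)) : (Tally.init l).val v = 0 := by
  induction l with
  | nil => rfl
  | cons a l ih =>
    change ((0 : ℕ) - (0 : ℕ) : ℤ) * v a.2 + (Tally.init l).val v = 0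
    simp [ih]

theorem Tally.val_eq_zero {v : ℕ → ℤ} {t : Tally} (h : t.isZero = true) : t.val v = 0 := by
  induction t with
  | nil => rfl
  | cons key T p m tl ih =>
    change cond (Nat.beq p m) tl.isZero false = true at h
    rw [Bool.cond_false_right, Bool.and_eq_true] at h
    simp [val, ih h.2, Nat.eq_of_beq_eq_true h.1]

theorem sumZ_eq (l : List α) (f : α → ℤ) : sumZ l f = (l.map f).sum := by
  induction l with
  | nil => rfl
  | cons a l ih =>
    change f a + sumZ l f = _
    rw [ih, List.map_cons, List.sum_cons]

theorem forceZ_spec (z : ℤ) (f : ℕ → ℕ → α) : ∃ p m : ℕ, forceZ z f = f p m ∧ (p : ℤ) - m = z := by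
  cases z with
  | ofNat a =>
    refine ⟨a, 0, ?_, by simp⟩
    change force a (fun a => f a 0) = _
    rw [force_eq]
  | negSucc a =>
    refine ⟨0, a + 1, ?_, by simp [Int.negSucc_eq]⟩
    change force (Nat.succ a) (fun a => f 0 a) = _
    rw [force_eq]

theorem withMasks_eq (pos l : List ℕ) (f : List (ℕ × ℕ) → α) :
    withMasks pos l f = f (l.map fun F => (F, mask pos F)) := by
  induction l generalizing f with
  | nil => rfl
  | cons a l ih =>
    change (force a fun F => force (mask pos F) fun m =>
      withMasks pos l fun t => f ((F, m) :: t)) = _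
    rw [force_eq, force_eq, ih]
    rfl

theorem classesWithMasks_eq (pos : List ℕ) (l : List (List ℤ × List ℕ))
    (f : List (List ℤ × List (ℕ × ℕ)) → α) :
    classesWithMasks pos l f =
      f (l.map fun c => (c.1, c.2.map fun F => (F, mask pos F))) := by
  induction l generalizing f with
  | nil => rfl
  | cons c l ih =>
    change (withMasks pos c.2 fun m =>
      classesWithMasks pos l fun t => f ((c.1, m) :: t)) = _
    rw [withMasks_eq, ih]
    rfl

end Spec

/-- Properties of `κ F G = kappa x y F G`, where `x` and `y` agree on at least two edges, that
suffice for the evaluation of weighted sums of its values. -/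
structure Adm (pos : List ℕ) (n : ℕ) (κ : ℕ → ℕ → ℤ) : Prop where
  few : ∀ F G, isInv pos n F = true → isInv pos n G = true →
    fewB (mask pos F &&& mask pos G) = true → κ F G = 0
  conj : ∀ A T F G S, isConj pos n A T F G S = true → κ F G = κ A T
  invariant : ∀ g h F G, isPerm pos n g h = true → isInv pos n F = true → isInv pos n G = true →
    κ (_root_.conjBy pos g h F) (_root_.conjBy pos g h G) = κ F G

section Sums

variable {pos : List ℕ} {n : ℕ}

theorem tallyRow_spec {A F wp wn : ℕ} {l : List ℕ} {acc : Tally} {f : Tally → Bool}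
    (hF : isInv pos n F = true)
    (hl : ∀ G ∈ l, isInv pos n G = true)
    (h : tallyRow pos n A F (mask pos F) wp wn (l.map fun G => (G, mask pos G)) acc f = true) :
    ∃ acc', f acc' = true ∧ ∀ κ, Adm pos n κ →
      acc'.val (κ A) = acc.val (κ A) + ((wp : ℤ) - wn) * (l.map (κ F)).sum := by
  induction l generalizing acc f with
  | nil => exact ⟨acc, h, by simp⟩
  | cons G l ih =>
    have hl' : ∀ G ∈ l, isInv pos n G = true := fun G hG => hl G (List.mem_cons_of_mem _ hG)
    have hG := hl G (by simp)
    change cond (fewB (mask pos F &&& mask pos G))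
      (tallyRow pos n A F (mask pos F) wp wn (l.map fun G => (G, mask pos G)) acc f)
      (canon pos F G fun S key =>
        Tally.add (fun T => isConj pos n A T F G S) key wp wn acc fun acc =>
          tallyRow pos n A F (mask pos F) wp wn (l.map fun G => (G, mask pos G)) acc f) = true at h
    cases hb : fewB (mask pos F &&& mask pos G)
    · rw [hb] at h
      obtain ⟨S, key, h⟩ := canon_spec h
      obtain ⟨T, acc₁, hT, h, h₁⟩ := Tally.add_spec h
      obtain ⟨acc₂, h, h₂⟩ := ih hl' h
      refine ⟨acc₂, h, fun κ hκ => ?_⟩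
      rw [h₂ κ hκ, h₁, List.map_cons, List.sum_cons, hκ.conj A T F G S hT]
      ring
    · rw [hb] at h
      obtain ⟨acc₂, h, h₂⟩ := ih hl' h
      refine ⟨acc₂, h, fun κ hκ => ?_⟩
      rw [h₂ κ hκ, List.map_cons, List.sum_cons, hκ.few F G hF hG hb]
      ring

theorem tallyHead_spec {A F len : ℕ} {s : List ℕ} {u : List ℤ} {cs : List (List ℤ × List ℕ)}
    {acc : Tally} {f : Tally → Bool}
    (hF : isInv pos n F = true)
    (hl : ∀ c ∈ cs, ∀ G ∈ c.2, isInv pos n G = true)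
    (h : tallyHead pos n A s u len F (mask pos F)
      (cs.map fun c => (c.1, c.2.map fun G => (G, mask pos G))) acc f = true) :
    ∃ acc', f acc' = true ∧ ∀ κ, Adm pos n κ →
      acc'.val (κ A) = acc.val (κ A) +
        (cs.map fun c => len * dot s u c.1 * (c.2.map (κ F)).sum).sum := by
  induction cs generalizing acc f with
  | nil => exact ⟨acc, h, by simp⟩
  | cons c cs ih =>
    change (forceZ (len * dot s u c.1) fun wp wn =>
      tallyRow pos n A F (mask pos F) wp wn (c.2.map fun G => (G, mask pos G)) acc fun acc =>
        tallyHead pos n A s u len F (mask pos F)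
          (cs.map fun c => (c.1, c.2.map fun G => (G, mask pos G))) acc f) = true at h
    obtain ⟨wp, wn, h', hw⟩ := forceZ_spec (len * dot s u c.1) fun wp wn =>
      tallyRow pos n A F (mask pos F) wp wn (c.2.map fun G => (G, mask pos G)) acc fun acc =>
        tallyHead pos n A s u len F (mask pos F)
          (cs.map fun c => (c.1, c.2.map fun G => (G, mask pos G))) acc f
    rw [h'] at h
    obtain ⟨acc₁, h, h₁⟩ := tallyRow_spec hF (hl c (by simp)) h
    obtain ⟨acc₂, h, h₂⟩ := ih (fun c hc => hl c (by simp [hc])) h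
    refine ⟨acc₂, h, fun κ hκ => ?_⟩
    rw [h₂ κ hκ, h₁ κ hκ, hw, List.map_cons, List.sum_cons, add_assoc]

theorem tallyAll_spec {A : ℕ} {s : List ℕ} {cs todo : List (List ℤ × List ℕ)}
    {acc : Tally} {f : Tally → Bool}
    (hcs : ∀ c ∈ cs, ∀ G ∈ c.2, isInv pos n G = true)
    (htodo : ∀ c ∈ todo, ∀ G ∈ c.2, isInv pos n G = true)
    (h : tallyAll pos n A s (cs.map fun c => (c.1, c.2.map fun G => (G, mask pos G)))
      (todo.map fun c => (c.1, c.2.map fun G => (G, mask pos G))) acc f = true) :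
    ∃ acc', f acc' = true ∧ ∀ κ, Adm pos n κ →
      acc'.val (κ A) = acc.val (κ A) + (todo.map fun c => (cs.map fun c' =>
        c.2.length * dot s c.1 c'.1 * (c'.2.map (κ (c.2.headD 0))).sum).sum).sum := by
  induction todo generalizing acc f with
  | nil => exact ⟨acc, h, by simp⟩
  | cons c todo ih =>
    obtain ⟨u, l⟩ := c
    cases l with
    | nil => cases h
    | cons F l =>
      change (tallyHead pos n A s u
          (List.length ((F, mask pos F) :: l.map fun G => (G, mask pos G))) F (mask pos F)
          (cs.map fun c => (c.1, c.2.map fun G => (G, mask pos G))) acc fun acc =>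
        tallyAll pos n A s (cs.map fun c => (c.1, c.2.map fun G => (G, mask pos G)))
          (todo.map fun c => (c.1, c.2.map fun G => (G, mask pos G))) acc f) = true at h
      obtain ⟨acc₁, h, h₁⟩ := tallyHead_spec (htodo (u, F :: l) (by simp) F (by simp)) hcs h
      obtain ⟨acc₂, h, h₂⟩ := ih (fun c hc => htodo c (by simp [hc])) h
      refine ⟨acc₂, h, fun κ hκ => ?_⟩
      rw [h₂ κ hκ, h₁ κ hκ, List.map_cons, List.sum_cons, add_assoc]
      simp

theorem sum_conj_eq {gens : List (ℕ × ℕ)} {l : List ℕ} {κ : ℕ → ℕ → ℤ} (hκ : Adm pos n κ)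
    (hl : ∀ F ∈ l, isInv pos n F = true) (hnodup : l.Nodup) (hclosed : closedB pos gens l = true)
    {g h F : ℕ} (hg : (g, h) ∈ gens) (hgh : isPerm pos n g h = true)
    (hF : isInv pos n F = true) :
    (l.map (κ (conjBy pos g h F))).sum = (l.map (κ F)).sum := by
  have hsub : l ⊆ l.map (conjBy pos g h) := by
    have := allB_iff.1 hclosed (g, h) hg
    rw [mapForce_eq, allB_iff] at this
    exact fun x hx => memB_iff.1 (this x hx)
  have hperm : l.Perm (l.map (conjBy pos g h)) :=
    (List.subperm_of_subset hnodup hsub).perm_of_length_le (by simp)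
  rw [(hperm.map _).sum_eq, List.map_map]
  exact congrArg List.sum (List.map_congr_left fun G hG => hκ.invariant g h F G hgh hF (hl G hG))

theorem sum_eq_of_linked {gens : List (ℕ × ℕ)} {l m : List ℕ} {κ : ℕ → ℕ → ℤ} (hκ : Adm pos n κ)
    (hl : ∀ F ∈ l, isInv pos n F = true) (hnodup : l.Nodup) (hclosed : closedB pos gens l = true)
    (hgens : ∀ g ∈ gens, isPerm pos n g.1 g.2 = true) {a : ℕ} (ha : isInv pos n a = true)
    (hm : ∀ F ∈ m, isInv pos n F = true) (hlink : linked pos gens m a = true) :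
    ∀ F ∈ m, (l.map (κ F)).sum = (l.map (κ a)).sum := by
  induction m generalizing a with
  | nil => simp
  | cons b m ih =>
    change cond (anyB gens fun g => cond (Nat.beq (conjBy pos g.1 g.2 a) b) true
      (Nat.beq (conjBy pos g.1 g.2 b) a)) (linked pos gens m b) false = true at hlink
    rw [Bool.cond_false_right, Bool.and_eq_true, anyB_iff] at hlink
    obtain ⟨⟨g, hg, hgab⟩, hlink⟩ := hlink
    have hb : isInv pos n b = true := hm b (by simp)
    have hab : (l.map (κ b)).sum = (l.map (κ a)).sum := by
      rw [Bool.cond_true_left, Bool.or_eq_true] at hgab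
      rcases hgab with h | h
      · rw [← Nat.eq_of_beq_eq_true h]
        exact sum_conj_eq hκ hl hnodup hclosed hg (hgens g hg) ha
      · rw [← Nat.eq_of_beq_eq_true h]
        exact (sum_conj_eq hκ hl hnodup hclosed hg (hgens g hg) hb).symm
    intro F hF
    rcases List.mem_cons.1 hF with rfl | hF
    · exact hab
    · rw [ih hb (fun F hF => hm F (by simp [hF])) hlink F hF, hab]

end Sums

namespace Cert

/-- The members of all classes, with their vectors of weights. -/
def items (C : Cert) : List (List ℤ × ℕ) :=
  C.classes.flatMap fun c => c.2.map fun F => (c.1, F)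

theorem sum_items {C : Cert} (f : List ℤ × ℕ → ℤ) :
    (C.items.map f).sum = (C.classes.map fun c => (c.2.map fun F => f (c.1, F)).sum).sum := by
  unfold items
  induction C.classes with
  | nil => rfl
  | cons c l ih => simp [ih, Function.comp_def]

theorem checkOrbits_iff {C : Cert} : C.checkOrbits = true ↔
    isInv C.pos C.n C.base = true ∧ (∀ g ∈ C.gens, isPerm C.pos C.n g.1 g.2 = true) ∧
    ∀ c ∈ C.classes, (∀ F ∈ c.2, isInv C.pos C.n F = true) ∧ c.2.Nodup ∧
      closedB C.pos C.gens c.2 = true ∧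
      (List.rec false (fun a t _ => linked C.pos C.gens t a) c.2 : Bool) = true := by
  simp only [checkOrbits, Bool.cond_false_right, Bool.and_eq_true, allB_iff, nodupB_iff]

theorem sum_pairs {C : Cert} (hC : C.checkOrbits = true) {κ : ℕ → ℕ → ℤ}
    (hκ : Adm C.pos C.n κ) :
    (C.items.map fun a => (C.items.map fun b => dot C.scale a.1 b.1 * κ a.2 b.2).sum).sum =
      (C.classes.map fun c => (C.classes.map fun c' =>
        c.2.length * dot C.scale c.1 c'.1 * (c'.2.map (κ (c.2.headD 0))).sum).sum).sum := by
  obtain ⟨-, hgens, hcl⟩ := checkOrbits_iff.1 hC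
  rw [sum_items]
  refine congrArg List.sum (List.map_congr_left fun c hc => ?_)
  obtain ⟨u, l⟩ := c
  cases l with
  | nil => simp
  | cons a t =>
    obtain ⟨hI, -, -, hlink⟩ := hcl _ hc
    have key : ∀ F ∈ a :: t,
        (C.items.map fun b => dot C.scale u b.1 * κ F b.2).sum =
        (C.classes.map fun c' => dot C.scale u c'.1 * (c'.2.map (κ a)).sum).sum := by
      intro F hF
      rw [sum_items]
      refine congrArg List.sum (List.map_congr_left fun c' hc' => ?_)
      obtain ⟨hI', hnodup, hclosed, -⟩ := hcl _ hc'
      refine (List.sum_map_mul_left c'.2 (κ F) (dot C.scale u c'.1)).trans ?_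
      congr 1
      rcases List.mem_cons.1 hF with rfl | hF
      · rfl
      · exact sum_eq_of_linked hκ hI' hnodup hclosed hgens (hI a (by simp))
          (fun F hF => hI F (by simp [hF])) hlink F hF
    rw [List.map_congr_left key, List.map_const', List.sum_replicate, nsmul_eq_mul,
      ← List.sum_map_mul_left]
    simp [mul_assoc]

theorem total_eq (C : Cert) :
    C.total = (C.items.map fun a => (C.items.map fun b => dot C.scale a.1 b.1).sum).sum := by
  simp only [total, sumZ_eq, sum_items, List.map_const', List.sum_replicate, nsmul_eq_mul]
  refine congrArg List.sum (List.map_congr_left fun c _ => ?_)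
  rw [← List.sum_map_mul_left]
  refine congrArg List.sum (List.map_congr_left fun c' _ => ?_)
  exact mul_assoc _ _ _

theorem spec {C : Cert} (hO : C.checkOrbits = true) (hP : C.checkPairs = true) (hn : 3 < C.n) :
    ∃ d : ℤ, 0 < d ∧
      (C.items.map fun a => (C.items.map fun b => dot C.scale a.1 b.1).sum).sum =
        (C.n - 1) * (C.n - 3) * d ∧
      ∀ κ, Adm C.pos C.n κ →
        (C.items.map fun a => (C.items.map fun b => dot C.scale a.1 b.1 * κ a.2 b.2).sum).sum =
          d * κ C.base C.base := by
  obtain ⟨-, -, hcl⟩ := checkOrbits_iff.1 hO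
  rw [checkPairs, classesWithMasks_eq] at hP
  obtain ⟨acc, h, hval⟩ := tallyAll_spec (fun c hc => (hcl c hc).1) (fun c hc => (hcl c hc).1) hP
  cases acc with
  | nil => cases h
  | cons key T p m tl =>
    simp only [Bool.cond_false_right, Bool.and_eq_true, force_eq] at h
    obtain ⟨h1, h2, h3, h4⟩ := h
    have h1 := Nat.eq_of_beq_eq_true h1
    have h2 : m < p := by simpa [Nat.blt] using h2
    have h4 : (C.n - 1) * (C.n - 3) * p = (C.n - 1) * (C.n - 3) * m + C.total.toNat :=
      Nat.eq_of_beq_eq_true h4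
    have hr : 0 < (C.n - 1) * (C.n - 3) := Nat.mul_pos (by omega) (by omega)
    have ht : 0 < C.total.toNat := by
      have := Nat.mul_lt_mul_of_pos_left h2 hr
      omega
    refine ⟨(p : ℤ) - m, by omega, ?_, fun κ hκ => ?_⟩
    · rw [← total_eq]
      have h5 : C.total = (C.total.toNat : ℤ) := by omega
      rw [h5]
      zify [show 1 ≤ C.n by omega, show 3 ≤ C.n by omega] at h4
      linarith
    · rw [sum_pairs hO hκ]
      have := hval κ hκ
      rw [Tally.val_init, zero_add] at this
      rw [← this, Tally.val, Tally.val_eq_zero h3, h1, add_zero]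

end Cert

section Kappa

variable {n : ℕ}

/-- The function on `Fin n` coded by `F`. -/
def fn (n F : ℕ) (i : Fin n) : Fin n := ⟨ev F i % n, Nat.mod_lt _ i.pos⟩

/-- Involutions without fixed points; these are the partner functions of perfect matchings. -/
def IsFpf (x : Fin n → Fin n) : Prop := (∀ i, x (x i) = i) ∧ ∀ i, x i ≠ i

instance : DecidablePred (IsFpf (n := n)) := fun _ => by
  unfold IsFpf; infer_instance

/-- The number of permutations carrying `x` to `f` and `y` to `g`. -/
def kappa (x y f g : Fin n → Fin n) : ℕ :=
  (Finset.univ.filter fun h : Equiv.Perm (Fin n) =>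
    (∀ i, h (x i) = f (h i)) ∧ ∀ i, h (y i) = g (h i)).card

/-- The matchings with partner functions `x` and `y` have at least two edges in common. -/
def AgreeTwice (x y : Fin n → Fin n) : Prop :=
  ∃ i j, x i = y i ∧ x j = y j ∧ j ≠ i ∧ j ≠ x i

theorem kappa_eq_of_perm {x y f g f' g' : Fin n → Fin n} (σ : Equiv.Perm (Fin n))
    (hf : ∀ i, f (σ i) = σ (f' i)) (hg : ∀ i, g (σ i) = σ (g' i)) :
    kappa x y f g = kappa x y f' g' := by
  symm
  refine Finset.card_nbij' (fun h => h.trans σ) (fun h => h.trans σ.symm) ?_ ?_ ?_ ?_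
  · intro h hh
    simp only [Finset.coe_filter, Finset.mem_univ, true_and, Set.mem_ofPred_eq, Equiv.trans_apply,
      hf, hg, EmbeddingLike.apply_eq_iff_eq] at hh ⊢
    exact hh
  · intro h hh
    simp only [Finset.coe_filter, Finset.mem_univ, true_and, Set.mem_ofPred_eq, Equiv.trans_apply,
      Equiv.symm_apply_eq, ← hf, ← hg, Equiv.apply_symm_apply] at hh ⊢
    exact hh
  · intro h _
    ext
    simp
  · intro h _
    ext
    simp

theorem ev_lt (F i : ℕ) : ev F i < 32 := by
  rw [ev_eq]
  exact Nat.mod_lt _ (by norm_num)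

theorem isFpf_fn {F : ℕ} (hF : isInv (List.range n) n F = true) : IsFpf (fn n F) := by
  rw [isInv_iff] at hF
  refine ⟨fun i => ?_, fun i h => ?_⟩
  · obtain ⟨h1, -, h2⟩ := hF i (by simp)
    ext
    simp [fn, Nat.mod_eq_of_lt h1, h2, Nat.mod_eq_of_lt i.2]
  · obtain ⟨h1, h2, -⟩ := hF i (by simp)
    have h3 := congrArg Fin.val h
    simp only [fn, Nat.mod_eq_of_lt h1] at h3
    exact h2 h3

theorem eq_of_fewB {x p q : ℕ} (hx : fewB x = true) (hp : x.testBit p = true)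
    (hq : x.testBit q = true) : p = q := by
  have key : ∀ {p q : ℕ}, x.testBit p = true → x.testBit q = true → ¬ p < q := by
    intro p q hp hq hpq
    have h0 : x &&& (x - 1) = 0 := Nat.eq_of_beq_eq_true hx
    have h1 : (x - 1).testBit q = true := by
      have h2 : (x % 2 ^ q).testBit p = true := by simp [hpq, hp]
      have h3 : x % 2 ^ q ≠ 0 := fun h => by simp [h] at h2
      have h4 : (x - 1) / 2 ^ q = x / 2 ^ q := by
        have h5 := Nat.div_add_mod x (2 ^ q)
        have h6 := Nat.mod_lt x (Nat.two_pow_pos q)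
        refine Nat.div_eq_of_lt_le ?_ ?_
        · rw [mul_comm]; omega
        · rw [mul_comm, mul_add]; omega
      rw [Nat.testBit_eq_decide_div_mod_eq] at hq ⊢
      rw [h4]
      exact hq
    have := congrArg (Nat.testBit · q) h0
    simp [hq, h1] at this
  have := key hp hq
  have := key hq hp
  omega

theorem testBit_mask {F a : ℕ} (hF : isInv (List.range n) n F = true) (ha : a < n) :
    (mask (List.range n) F).testBit (32 * min a (ev F a) + max a (ev F a)) = true := by
  rw [isInv_iff] at hF
  obtain ⟨h1, h2, h3⟩ := hF a (by simpa using ha)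
  refine testBit_orB.2 ⟨min a (ev F a), by simp [ha], ?_⟩
  rw [force_eq]
  rcases lt_or_gt_of_ne h2 with h | h
  · have : Nat.blt (ev F a) a = true := by simpa [Nat.blt] using h
    rw [min_eq_right h.le, max_eq_left h.le, h3, this, cond_true]
    change ((1 <<< (32 * ev F a + a)) : ℕ).testBit _ = true
    simp [Nat.one_shiftLeft]
  · have : Nat.blt a (ev F a) = true := by simpa [Nat.blt] using h
    rw [min_eq_left h.le, max_eq_right h.le, this, cond_true]
    change ((1 <<< (32 * a + ev F a)) : ℕ).testBit _ = true
    simp [Nat.one_shiftLeft]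

theorem kappa_eq_zero {x y : Fin n → Fin n} (hxy : AgreeTwice x y) {F G : ℕ}
    (hF : isInv (List.range n) n F = true) (hG : isInv (List.range n) n G = true)
    (hFG : fewB (mask (List.range n) F &&& mask (List.range n) G) = true) :
    kappa x y (fn n F) (fn n G) = 0 := by
  by_contra hne
  obtain ⟨h, hh⟩ := Finset.card_pos.1 (Nat.pos_of_ne_zero hne)
  simp only [Finset.mem_filter, Finset.mem_univ, true_and] at hh
  obtain ⟨i, j, hi, hj, hji, hjx⟩ := hxy
  have hFn := isInv_iff.1 hF
  have hGn := isInv_iff.1 hG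
  have ev_eq_ev : ∀ i, x i = y i → ev F (h i) = ev G (h i) := fun i hi => by
    have h1 : fn n F (h i) = fn n G (h i) := by rw [← hh.1, ← hh.2, hi]
    have h2 := congrArg Fin.val h1
    simpa only [fn, Nat.mod_eq_of_lt (hFn (h i) (by simp)).1,
      Nat.mod_eq_of_lt (hGn (h i) (by simp)).1] using h2
  have bit : ∀ i, x i = y i → (mask (List.range n) F &&& mask (List.range n) G).testBit
      (32 * min (h i : ℕ) (ev F (h i)) + max (h i : ℕ) (ev F (h i))) = true := fun i hi => by
    rw [Nat.testBit_and, testBit_mask hF (h i).2, ev_eq_ev i hi, testBit_mask hG (h i).2]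
    rfl
  have heq := eq_of_fewB hFG (bit i hi) (bit j hj)
  have hne1 : (h j : ℕ) ≠ h i := fun e => hji (h.injective (Fin.ext e))
  have hne2 : (h j : ℕ) ≠ ev F (h i) := fun e => hjx (h.injective (by
    rw [hh.1]
    exact Fin.ext (by simp only [fn, e, Nat.mod_eq_of_lt (hFn (h i) (by simp)).1])))
  obtain ⟨-, -, hii⟩ := hFn (h i) (by simp)
  obtain ⟨-, -, hjj⟩ := hFn (h j) (by simp)
  have l1 := ev_lt F (h i)
  have l2 := ev_lt F (h j)
  have l3 := ev_lt F (ev F (h i))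
  have l4 := ev_lt F (ev F (h j))
  omega

theorem adm_kappa {x y : Fin n → Fin n} (hxy : AgreeTwice x y) :
    Adm (List.range n) n fun F G => (kappa x y (fn n F) (fn n G) : ℤ) where
  few F G hF hG hFG := by rw [kappa_eq_zero hxy hF hG hFG, Nat.cast_zero]
  conj A T F G S hS := by
    obtain ⟨hbits, hconj⟩ := isConj_eq_true_iff.1 hS
    have hlt : ∀ p : Fin n, ev S p < n := fun p => by
      have : (2 ^ n - 1).testBit (ev S p) = true := by
        rw [← hbits]
        exact testBit_orB.2 ⟨p, by simp, by simp⟩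
      simpa [Nat.testBit_two_pow_sub_one] using this
    have hsurj : Function.Surjective fun p : Fin n => (⟨ev S p, hlt p⟩ : Fin n) := fun b => by
      have : (2 ^ n - 1).testBit b = true := by simp [Nat.testBit_two_pow_sub_one]
      rw [← hbits] at this
      obtain ⟨p, hp, hb⟩ := testBit_orB.1 this
      exact ⟨⟨p, by simpa using hp⟩, Fin.ext (by simpa [Nat.testBit_two_pow] using hb)⟩
    refine congrArg Nat.cast (kappa_eq_of_perm
      (Equiv.ofBijective _ (Finite.surjective_iff_bijective.1 hsurj)) (fun p => ?_) fun p => ?_)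
    · ext
      have h := hlt (fn n A p)
      simp only [fn] at h
      simp [fn, (hconj p (by simp)).1, Nat.mod_eq_of_lt h]
    · ext
      have h := hlt (fn n T p)
      simp only [fn] at h
      simp [fn, (hconj p (by simp)).2, Nat.mod_eq_of_lt h]
  invariant g h F G hgh hF hG := by
    rw [isPerm_iff] at hgh
    have hinj : Function.Injective
        fun p : Fin n => (⟨ev g p, (hgh p (by simp)).1⟩ : Fin n) := fun p q hpq => by
      have := congrArg (ev h) (congrArg Fin.val hpq)
      simp only [(hgh p (by simp)).2, (hgh q (by simp)).2] at this
      exact Fin.ext this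
    have key : ∀ F, isInv (List.range n) n F = true → ∀ p : Fin n,
        fn n (conjBy (List.range n) g h F) (Equiv.ofBijective _ (Finite.injective_iff_bijective.1 hinj) p) =
          Equiv.ofBijective _ (Finite.injective_iff_bijective.1 hinj) (fn n F p) := by
      intro F hF p
      have h1 := (isInv_iff.1 hF p (by simp)).1
      obtain ⟨h2, h3⟩ := hgh p (by simp)
      have h4 := (hgh (ev F p) (by simpa using h1)).1
      ext
      simp only [fn, Equiv.ofBijective_apply, Nat.mod_eq_of_lt h1, conjBy]
      rw [ev_pack (fun _ _ => ev_lt _ _) (by simpa using h2), List.getElem_range, h3,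
        Nat.mod_eq_of_lt h4]
    exact congrArg Nat.cast (kappa_eq_of_perm _ (key F hF) (key G hG))

end Kappa

section Averaging

open Matrix

/-- Fixed-point free involutions of `Fin n`. -/
abbrev Fpf (n : ℕ) := {x : Fin n → Fin n // IsFpf x}

variable {n : ℕ}

theorem kappa_comm (x y f g : Fin n → Fin n) : kappa x y f g = kappa y x g f := by
  simp only [kappa, and_comm]

theorem kappa_swap (x y f g : Fin n → Fin n) : kappa x y f g = kappa f g x y := by
  refine Finset.card_nbij' (fun h => h.symm) (fun h => h.symm) ?_ ?_ ?_ ?_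
  all_goals intro h hh
  · simp only [Finset.coe_filter, Finset.mem_univ, true_and, Set.mem_ofPred_eq] at hh ⊢
    exact ⟨fun i => by rw [Equiv.symm_apply_eq, hh.1, Equiv.apply_symm_apply],
      fun i => by rw [Equiv.symm_apply_eq, hh.2, Equiv.apply_symm_apply]⟩
  · simp only [Finset.coe_filter, Finset.mem_univ, true_and, Set.mem_ofPred_eq] at hh ⊢
    exact ⟨fun i => by rw [Equiv.symm_apply_eq, hh.1, Equiv.apply_symm_apply],
      fun i => by rw [Equiv.symm_apply_eq, hh.2, Equiv.apply_symm_apply]⟩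
  · rfl
  · rfl

theorem cycleType_toPerm {x : Fin n → Fin n} (hx : IsFpf x) (hn : 0 < n) :
    (Function.Involutive.toPerm x hx.1).cycleType = Multiset.replicate (n / 2) 2 := by
  set σ := Function.Involutive.toPerm x hx.1
  have h1 : orderOf σ = 2 := by
    refine orderOf_eq_prime (Equiv.ext fun i => ?_) fun h => hx.2 ⟨0, hn⟩ ?_
    · rw [pow_two]
      exact hx.1 i
    · exact Equiv.congr_fun h ⟨0, hn⟩
  obtain ⟨m, hm⟩ := Equiv.Perm.cycleType_prime_order (σ := σ) (by rw [h1]; exact Nat.prime_two)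
  have h2 : σ.support = Finset.univ := by
    ext i
    simp only [Equiv.Perm.mem_support, Finset.mem_univ, iff_true]
    exact hx.2 i
  have h3 := Equiv.Perm.sum_cycleType σ
  rw [hm, h1, h2, Multiset.sum_replicate, smul_eq_mul, Finset.card_univ, Fintype.card_fin] at h3
  rw [hm, h1, ← h3, Nat.mul_div_cancel _ two_pos]

theorem exists_perm_conj {x y : Fin n → Fin n} (hx : IsFpf x) (hy : IsFpf y) :
    ∃ σ : Equiv.Perm (Fin n), ∀ i, σ (x i) = y (σ i) := by
  rcases Nat.eq_zero_or_pos n with rfl | hn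
  · exact ⟨1, fun i => i.elim0⟩
  · obtain ⟨σ, hσ⟩ := isConj_iff.1 (Equiv.Perm.isConj_iff_cycleType_eq.2
      ((cycleType_toPerm hx hn).trans (cycleType_toPerm hy hn).symm))
    refine ⟨σ, fun i => ?_⟩
    exact Equiv.congr_fun (mul_inv_eq_iff_eq_mul.1 hσ) i

theorem kappa_self_eq {x y f g : Fin n → Fin n} (hx : IsFpf x) (hy : IsFpf y) (hf : IsFpf f)
    (hg : IsFpf g) : kappa x x f f = kappa y y g g := by
  obtain ⟨σ, hσ⟩ := exists_perm_conj hg hf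
  obtain ⟨τ, hτ⟩ := exists_perm_conj hy hx
  rw [kappa_eq_of_perm σ (fun i => (hσ i).symm) fun i => (hσ i).symm, kappa_swap,
    kappa_eq_of_perm τ (fun i => (hτ i).symm) fun i => (hτ i).symm, kappa_swap]

theorem kappa_self_pos (x : Fin n → Fin n) : 0 < kappa x x x x :=
  Finset.card_pos.2 ⟨1, by simp⟩

theorem kappa_eq_zero_of_ne {x y : Fin n → Fin n} (hxy : x ≠ y) (f : Fin n → Fin n) :
    kappa x y f f = 0 := by
  refine Finset.card_eq_zero.2 (Finset.filter_eq_empty_iff.2 fun h _ hh => hxy ?_)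
  funext i
  exact h.injective ((hh.1 i).trans (hh.2 i).symm)

theorem natCast_kappa (x y f g : Fin n → Fin n) :
    (kappa x y f g : ℝ) = ∑ h : Equiv.Perm (Fin n),
      (if ∀ i, h (x i) = f (h i) then 1 else 0) * (if ∀ i, h (y i) = g (h i) then 1 else 0) := by
  rw [kappa, Finset.natCast_card_filter]
  refine Finset.sum_congr rfl fun h _ => ?_
  rw [ite_and]
  split_ifs <;> simp

theorem sum_kappa (x : Fin n → Fin n) (f : Fin n → Fin n) {g : Fin n → Fin n} (hg : IsFpf g) :
    ∑ y : Fpf n, (kappa x y.1 f g : ℝ) = kappa x x f f := by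
  simp only [natCast_kappa]
  rw [Finset.sum_comm]
  refine Finset.sum_congr rfl fun h _ => ?_
  rw [← Finset.mul_sum]
  have key : ∑ y : Fpf n, (if ∀ i, h (y.1 i) = g (h i) then (1 : ℝ) else 0) = 1 := by
    let y : Fpf n := ⟨fun i => h.symm (g (h i)), fun i => by simp [hg.1], fun i hi =>
      hg.2 (h i) (by rwa [Equiv.symm_apply_eq] at hi)⟩
    rw [Finset.sum_eq_single y]
    · simp [y]
    · intro z _ hz
      refine if_neg fun hz' => hz (Subtype.ext (funext fun i => ?_))
      simp [y, ← hz']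
    · simp
  rw [key]
  split_ifs <;> simp

theorem exists_mulVec_eq_zero {X : Type} [Fintype X] [DecidableEq X] {N : Matrix X X ℝ}
    (hN : N.PosSemidef) {r : ℝ} (hrow : ∀ x, ∑ y, N x y = r) {F : Finset X}
    (hF : ∀ x ∈ F, ∀ y ∈ F, N x y = if x = y then 1 else 0)
    (hcard : Fintype.card X ≤ r * F.card) {a b : X} (ha : a ∈ F) (hb : b ∉ F) :
    ∃ v : X → ℝ, v ≠ 0 ∧ N *ᵥ v = 0 := by
  let v : X → ℝ := fun x => Fintype.card X * (if x ∈ F then 1 else 0) - F.card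
  have hcol : ∀ y, ∑ x, N x y = r := fun y => by
    rw [← hrow y]
    exact Finset.sum_congr rfl fun x _ => (hN.1.apply x y).symm
  have hv : ∀ x, (N *ᵥ v) x = Fintype.card X * ∑ y ∈ F, N x y - F.card * r := fun x => by
    have h1 : (N *ᵥ v) x = ∑ y, N x y * v y := rfl
    have h2 : ∑ y, N x y * (if y ∈ F then (1 : ℝ) else 0) = ∑ y ∈ F, N x y := by
      simp [Finset.sum_ite_mem]
    rw [h1, ← hrow x, ← h2, Finset.mul_sum, Finset.mul_sum, ← Finset.sum_sub_distrib]
    exact Finset.sum_congr rfl fun y _ => by simp only [v]; ring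
  have hsumF : ∑ x ∈ F, (N *ᵥ v) x = F.card * (Fintype.card X - r * F.card) := by
    have h1 : ∑ x ∈ F, ∑ y ∈ F, N x y = F.card := by
      rw [Finset.sum_congr rfl fun x hx => Finset.sum_congr rfl fun y hy => hF x hx y hy]
      simp
    simp only [hv, Finset.sum_sub_distrib, ← Finset.mul_sum, h1, Finset.sum_const, nsmul_eq_mul]
    ring
  have hsum : ∑ x, (N *ᵥ v) x = 0 := by
    have h1 : ∑ x, ∑ y ∈ F, N x y = F.card * r := by
      refine Finset.sum_comm.trans ?_
      simp [hcol]
    simp only [hv, Finset.sum_sub_distrib, ← Finset.mul_sum, h1, Finset.sum_const, nsmul_eq_mul,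
      Finset.card_univ]
    ring
  have hquad : star v ⬝ᵥ N *ᵥ v = Fintype.card X * (F.card * (Fintype.card X - r * F.card)) := by
    have h1 : star v ⬝ᵥ N *ᵥ v = ∑ x, v x * (N *ᵥ v) x := rfl
    have h2 : ∑ x, (if x ∈ F then (1 : ℝ) else 0) * (N *ᵥ v) x = ∑ x ∈ F, (N *ᵥ v) x := by
      simp [Finset.sum_ite_mem]
    rw [h1, ← hsumF, ← sub_zero (_ * _), ← mul_zero (F.card : ℝ), ← hsum, ← h2, Finset.mul_sum,
      Finset.mul_sum, ← Finset.sum_sub_distrib]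
    exact Finset.sum_congr rfl fun y _ => by simp only [v]; ring
  refine ⟨v, fun h0 => ?_, ?_⟩
  · have h1 := congrFun h0 a
    have h2 := congrFun h0 b
    have h3 : (0 : ℝ) < F.card := by exact_mod_cast Finset.card_pos.2 ⟨a, ha⟩
    simp only [v, hb, Pi.zero_apply] at h2
    norm_num at h2
    simp [h2] at ha
  · rw [← hN.dotProduct_mulVec_zero_iff]
    refine le_antisymm ?_ (hN.dotProduct_mulVec_nonneg v)
    rw [hquad]
    exact mul_nonpos_of_nonneg_of_nonpos (by positivity)
      (mul_nonpos_of_nonneg_of_nonpos (by positivity) (by linarith))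

/-- Conjugation by a transposition. -/
def conjSwap (a b : Fin n) (x : Fpf n) : Fpf n :=
  ⟨fun i => Equiv.swap a b (x.1 (Equiv.swap a b i)), fun i => by simp [x.2.1],
    fun i hi => x.2.2 (Equiv.swap a b i) (by
      rwa [Equiv.swap_apply_eq_iff] at hi)⟩

theorem conjSwap_injective (a b : Fin n) : Function.Injective (conjSwap a b) := by
  intro x y hxy
  refine Subtype.ext (funext fun i => ?_)
  have := congrFun (congrArg Subtype.val hxy) (Equiv.swap a b i)
  simpa [conjSwap] using this

theorem card_fpf_le {a b c e : Fin n} (hab : a ≠ b) (hac : a ≠ c) (hae : a ≠ e) (hbc : b ≠ c)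
    (hbe : b ≠ e) (hce : c ≠ e) :
    Fintype.card (Fpf n) ≤
      (Finset.univ.filter fun x : Fpf n => x.1 a = b ∧ x.1 c = e).card * (n - 3) * (n - 1) := by
  have h1 : (Finset.univ.filter fun x : Fpf n => x.1 a = b).card ≤
      (Finset.univ.filter fun x : Fpf n => x.1 a = b ∧ x.1 c = e).card * (n - 3) := by
    have h2 : (({a, b, c} : Finset (Fin n))ᶜ).card = n - 3 := by
      rw [Finset.card_compl, Fintype.card_fin, Finset.card_eq_three.2 ⟨a, b, c, hab, hac, hbc, rfl⟩]
    rw [← h2]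
    refine Finset.card_le_mul_card_image_of_maps_to (f := fun x => x.1 c) ?_ _ ?_
    · intro x hx
      simp only [Finset.mem_filter, Finset.mem_univ, true_and] at hx
      simp only [Finset.mem_compl, Finset.mem_insert, Finset.mem_singleton, not_or]
      refine ⟨fun h => hbc ?_, fun h => hac ?_, x.2.2 c⟩
      · rw [← hx, ← h, x.2.1]
      · rw [← x.2.1 a, hx, ← h, x.2.1]
    · intro d hd
      simp only [Finset.mem_compl, Finset.mem_insert, Finset.mem_singleton, not_or] at hd
      refine Finset.card_le_card_of_injOn (conjSwap d e) ?_ (conjSwap_injective d e).injOn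
      intro x hx
      simp only [Finset.coe_filter, Finset.mem_filter, Finset.mem_univ, true_and,
        Set.mem_ofPred_eq] at hx ⊢
      simp only [conjSwap]
      rw [Equiv.swap_apply_of_ne_of_ne (Ne.symm hd.1) hae, hx.1,
        Equiv.swap_apply_of_ne_of_ne (Ne.symm hd.2.1) hbe,
        Equiv.swap_apply_of_ne_of_ne (Ne.symm hd.2.2) hce, hx.2, Equiv.swap_apply_left]
      exact ⟨rfl, rfl⟩
  refine le_trans ?_ (Nat.mul_le_mul_right (n - 1) h1)
  have h2 : (({a} : Finset (Fin n))ᶜ).card = n - 1 := by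
    rw [Finset.card_compl, Fintype.card_fin, Finset.card_singleton]
  rw [← h2, ← Finset.card_univ]
  refine Finset.card_le_mul_card_image_of_maps_to (f := fun x => x.1 a) ?_ _ ?_
  · intro x _
    simpa using x.2.2 a
  · intro d hd
    simp only [Finset.mem_compl, Finset.mem_singleton] at hd
    refine Finset.card_le_card_of_injOn (conjSwap d b) ?_ (conjSwap_injective d b).injOn
    intro x hx
    simp only [Finset.coe_filter, Finset.mem_univ, true_and, Set.mem_ofPred_eq] at hx ⊢
    simp only [conjSwap]
    rw [Equiv.swap_apply_of_ne_of_ne (Ne.symm hd) hab, hx, Equiv.swap_apply_left]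

end Averaging

section Existence

open Matrix

variable {n : ℕ} {ι : Type} [Fintype ι]

/-- The average, over all permutations carrying `x` and `y` to members of the family `f`, of the
corresponding weights; not normalized. -/
noncomputable def weightedSum (W : ι → ι → ℝ) (f : ι → Fin n → Fin n) :
    Matrix (Fpf n) (Fpf n) ℝ :=
  fun x y => ∑ i, ∑ j, W i j * kappa x.1 y.1 (f i) (f j)

theorem weightedSum_posSemidef {W : ι → ι → ℝ} (hsymm : ∀ i j, W i j = W j i)
    (hpos : ∀ c : ι → ℝ, 0 ≤ ∑ i, ∑ j, W i j * (c i * c j)) (f : ι → Fin n → Fin n) :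
    (weightedSum W f).PosSemidef := by
  refine Matrix.PosSemidef.of_dotProduct_mulVec_nonneg ?_ fun v => ?_
  · ext x y
    simp only [weightedSum, conjTranspose_apply, star_trivial]
    rw [Finset.sum_comm]
    exact Finset.sum_congr rfl fun i _ => Finset.sum_congr rfl fun j _ => by
      rw [hsymm, kappa_comm]
  · let c : Equiv.Perm (Fin n) → ι → ℝ := fun h i =>
      ∑ x : Fpf n, v x * (if ∀ k, h (x.1 k) = f i (h k) then 1 else 0)
    have key : star v ⬝ᵥ weightedSum W f *ᵥ v = ∑ h, ∑ i, ∑ j, W i j * (c h i * c h j) := by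
      calc star v ⬝ᵥ weightedSum W f *ᵥ v
          = ∑ x, ∑ y, ∑ i, ∑ j, ∑ h : Equiv.Perm (Fin n), W i j *
              ((v x * (if ∀ k, h (x.1 k) = f i (h k) then 1 else 0)) *
              (v y * (if ∀ k, h (y.1 k) = f j (h k) then 1 else 0))) := by
            simp only [dotProduct, mulVec, weightedSum, natCast_kappa, Finset.mul_sum,
              Finset.sum_mul, Pi.star_apply, star_trivial]
            refine Finset.sum_congr rfl fun x _ => Finset.sum_congr rfl fun y _ =>
              Finset.sum_congr rfl fun i _ => Finset.sum_congr rfl fun j _ =>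
              Finset.sum_congr rfl fun h _ => by ring
        _ = ∑ i, ∑ j, ∑ h : Equiv.Perm (Fin n), ∑ x, ∑ y, W i j *
              ((v x * (if ∀ k, h (x.1 k) = f i (h k) then 1 else 0)) *
              (v y * (if ∀ k, h (y.1 k) = f j (h k) then 1 else 0))) := by
            simp only [Finset.sum_comm (s := (Finset.univ : Finset (Fpf n)))
              (t := (Finset.univ : Finset ι)),
              Finset.sum_comm (s := (Finset.univ : Finset (Fpf n)))
              (t := (Finset.univ : Finset (Equiv.Perm (Fin n))))]
        _ = ∑ i, ∑ j, ∑ h, W i j * (c h i * c h j) := by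
            refine Finset.sum_congr rfl fun i _ => Finset.sum_congr rfl fun j _ =>
              Finset.sum_congr rfl fun h _ => ?_
            simp only [c]
            rw [Finset.sum_mul_sum]
            simp only [Finset.mul_sum]
        _ = _ := by
            rw [Finset.sum_congr rfl fun i _ => Finset.sum_comm, Finset.sum_comm]
    rw [key]
    exact Finset.sum_nonneg fun h _ => hpos (c h)

theorem sum_weightedSum (W : ι → ι → ℝ) {f : ι → Fin n → Fin n} (hf : ∀ i, IsFpf (f i))
    {A : Fin n → Fin n} (hA : IsFpf A) (x : Fpf n) :
    ∑ y, weightedSum W f x y = kappa A A A A * ∑ i, ∑ j, W i j := by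
  simp only [weightedSum]
  rw [Finset.sum_comm, Finset.mul_sum]
  refine Finset.sum_congr rfl fun i _ => ?_
  rw [Finset.sum_comm, Finset.mul_sum]
  refine Finset.sum_congr rfl fun j _ => ?_
  rw [← Finset.mul_sum, sum_kappa x.1 (f i) (hf j), kappa_self_eq x.2 hA (hf i) hA, mul_comm]

theorem exists_matrix (hn : 4 ≤ n) {W : ι → ι → ℝ} (hsymm : ∀ i j, W i j = W j i)
    (hpos : ∀ c : ι → ℝ, 0 ≤ ∑ i, ∑ j, W i j * (c i * c j)) {f : ι → Fin n → Fin n}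
    (hf : ∀ i, IsFpf (f i)) {A : Fin n → Fin n} (hA : IsFpf A) {d : ℝ} (hd : 0 < d)
    (hsum : ∑ i, ∑ j, W i j = (n - 1) * (n - 3) * d)
    (hagree : ∀ x y : Fin n → Fin n, AgreeTwice x y →
      ∑ i, ∑ j, W i j * kappa x y (f i) (f j) = d * kappa x y A A) :
    ∃ M : Matrix (Fpf n) (Fpf n) ℝ, M.IsSymm ∧
      (∀ x y : Fpf n, AgreeTwice x.1 y.1 → M x y = 0) ∧
      (∀ x, ∑ y, M x y = (n - 1) * (n - 3) - 1) ∧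
      (∃ v : Fpf n → ℝ, v ≠ 0 ∧ M *ᵥ v = (-1 : ℝ) • v) ∧
      ∀ (μ : ℝ) (v : Fpf n → ℝ), v ≠ 0 → M *ᵥ v = μ • v → -1 ≤ μ := by
  set s : ℝ := ((kappa A A A A : ℕ) : ℝ) with hs
  have hs0 : 0 < s := Nat.cast_pos.2 (kappa_self_pos A)
  let N : Matrix (Fpf n) (Fpf n) ℝ := (s * d)⁻¹ • weightedSum W f
  have hN : N.PosSemidef := (weightedSum_posSemidef hsymm hpos f).smul (by positivity)
  have hNagree : ∀ x y : Fpf n, AgreeTwice x.1 y.1 → N x y = if x = y then 1 else 0 := by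
    intro x y hxy
    have h1 : N x y = (s * d)⁻¹ * (d * kappa x.1 y.1 A A) := by
      rw [← hagree x.1 y.1 hxy]
      rfl
    rw [h1]
    split_ifs with h
    · rw [← h, kappa_self_eq x.2 hA hA hA, ← hs]
      field_simp
    · rw [kappa_eq_zero_of_ne fun e => h (Subtype.ext e)]
      simp
  have hNrow : ∀ x, ∑ y, N x y = (n - 1) * (n - 3) := by
    intro x
    have h1 : ∑ y, N x y = (s * d)⁻¹ * ∑ y, weightedSum W f x y := by
      rw [Finset.mul_sum]
      rfl
    rw [h1, sum_weightedSum W hf hA x, hsum, ← hs]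
    field_simp
  have hMv : ∀ v : Fpf n → ℝ, (N - 1) *ᵥ v = N *ᵥ v - v := fun v => by
    rw [sub_mulVec, one_mulVec]
  refine ⟨N - 1, ?_, fun x y hxy => ?_, fun x => ?_, ?_, fun μ v hv hμ => ?_⟩
  · rw [IsSymm, transpose_sub, transpose_one]
    congr 1
    ext x y
    exact hN.1.apply x y
  · rw [Matrix.sub_apply, hNagree x y hxy, one_apply, sub_self]
  · simp only [Matrix.sub_apply, Finset.sum_sub_distrib, hNrow, one_apply]
    simp
  · let a : Fin n := ⟨0, by omega⟩
    let b : Fin n := ⟨1, by omega⟩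
    let c : Fin n := ⟨2, by omega⟩
    let e : Fin n := ⟨3, by omega⟩
    have hab : a ≠ b := by simp [a, b]
    have hac : a ≠ c := by simp [a, c]
    have hae : a ≠ e := by simp [a, e]
    have hbc : b ≠ c := by simp [b, c]
    have hbe : b ≠ e := by simp [b, e]
    have hce : c ≠ e := by simp [c, e]
    have hcard := card_fpf_le hab hac hae hbc hbe hce
    set F := Finset.univ.filter fun x : Fpf n => x.1 a = b ∧ x.1 c = e with hF
    have hX : 0 < Fintype.card (Fpf n) := Fintype.card_pos_iff.2 ⟨⟨A, hA⟩⟩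
    obtain ⟨x, hx⟩ : F.Nonempty := by
      rw [← Finset.card_pos]
      exact Nat.pos_of_ne_zero fun h => by simp [h] at hcard; omega
    have hx' : x.1 a = b ∧ x.1 c = e := by simpa [hF] using hx
    have hy : conjSwap b c x ∉ F := by
      simp only [hF, Finset.mem_filter, Finset.mem_univ, true_and, not_and]
      intro h
      simp only [conjSwap] at h
      rw [Equiv.swap_apply_of_ne_of_ne hab hac, hx'.1, Equiv.swap_apply_left] at h
      exact absurd h.symm hbc
    obtain ⟨v, hv, hNv⟩ := exists_mulVec_eq_zero hN hNrow (F := F) (fun x hx y hy => by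
      simp only [hF, Finset.mem_filter, Finset.mem_univ, true_and] at hx hy
      refine hNagree x y ⟨a, c, by rw [hx.1, hy.1], by rw [hx.2, hy.2], hac.symm, ?_⟩
      rw [hx.1]
      exact hbc.symm) (by
        have h1 : ((n - 1 : ℕ) : ℝ) = n - 1 := by rw [Nat.cast_sub (by omega)]; simp
        have h3 : ((n - 3 : ℕ) : ℝ) = n - 3 := by rw [Nat.cast_sub (by omega)]; simp
        rw [← h1, ← h3]
        have : (Fintype.card (Fpf n) : ℝ) ≤ F.card * (n - 3 : ℕ) * (n - 1 : ℕ) := by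
          exact_mod_cast hcard
        linarith) hx hy
    exact ⟨v, hv, by rw [hMv, hNv, zero_sub, neg_one_smul]⟩
  · rw [hMv, sub_eq_iff_eq_add] at hμ
    have h1 := hN.dotProduct_mulVec_nonneg v
    have h2 : 0 < v ⬝ᵥ v := (dotProduct_self_star_pos_iff (v := v)).2 hv
    rw [hμ, star_trivial, dotProduct_add, dotProduct_smul, smul_eq_mul] at h1
    by_contra hlt
    nlinarith

end Existence

section Bridge

open Matrix

variable {n : ℕ}

/-- The edges of the matching with partner function `x`. -/
def edges (x : Fin n → Fin n) : Finset (Sym2 (Fin n)) := Finset.univ.image fun i => s(i, x i)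

theorem mem_edges {x : Fin n → Fin n} (hx : IsFpf x) {a b : Fin n} :
    s(a, b) ∈ edges x ↔ x a = b := by
  simp only [edges, Finset.mem_image, Finset.mem_univ, true_and, Sym2.eq_iff]
  constructor
  · rintro ⟨i, ⟨rfl, rfl⟩ | ⟨rfl, rfl⟩⟩
    · rfl
    · exact hx.1 _
  · rintro rfl
    exact ⟨a, Or.inl ⟨rfl, rfl⟩⟩

theorem isPM_edges {x : Fin n → Fin n} (hx : IsFpf x) : IsPM (edges x) := by
  refine ⟨fun e he => ?_, fun v => ⟨s(v, x v), ⟨(mem_edges hx).2 rfl, by simp⟩, ?_⟩⟩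
  · induction e with | _ a b
    rw [mem_edges hx] at he
    rw [Sym2.mk_isDiag_iff]
    rintro rfl
    exact hx.2 a he
  · rintro e ⟨he, hv⟩
    obtain ⟨b, rfl⟩ := Sym2.mem_iff_exists.1 hv
    rw [(mem_edges hx).1 he]

/-- Perfect matchings correspond to their partner functions. -/
def toPM (x : Fpf n) : PM n := ⟨edges x.1, isPM_edges x.2⟩

theorem toPM_bijective : Function.Bijective (toPM (n := n)) := by
  constructor
  · intro x y hxy
    have hxy : edges x.1 = edges y.1 := congrArg Subtype.val hxy
    refine Subtype.ext (funext fun i => Eq.symm ?_)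
    rw [← mem_edges y.2, ← hxy, mem_edges x.2]
  · rintro ⟨P, hP⟩
    have hex : ∀ v, ∃ b, s(v, b) ∈ P := fun v => by
      obtain ⟨e, ⟨he, hv⟩, -⟩ := hP.2 v
      obtain ⟨b, rfl⟩ := Sym2.mem_iff_exists.1 hv
      exact ⟨b, he⟩
    have huniq : ∀ {v b c}, s(v, b) ∈ P → s(v, c) ∈ P → b = c := fun {v b c} hb hc =>
      Sym2.congr_right.1 ((hP.2 v).unique ⟨hb, by simp⟩ ⟨hc, by simp⟩)
    choose x hx using hex
    have hxf : IsFpf x := by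
      refine ⟨fun i => huniq (hx (x i)) ?_, fun i hi => hP.1 _ (hx i) ?_⟩
      · rw [Sym2.eq_swap]
        exact hx i
      · rw [Sym2.mk_isDiag_iff, hi]
    refine ⟨⟨x, hxf⟩, Subtype.ext ?_⟩
    ext e
    induction e with | _ a b
    change s(a, b) ∈ edges x ↔ s(a, b) ∈ P
    rw [mem_edges hxf]
    constructor
    · rintro rfl
      exact hx a
    · exact huniq (hx a)

theorem agreeTwice_of_two_le {x y : Fpf n} (h : 2 ≤ ((toPM x).1 ∩ (toPM y).1).card) :
    AgreeTwice x.1 y.1 := by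
  obtain ⟨e, he, e', he', hne⟩ := Finset.one_lt_card.1 h
  induction e with | _ a b
  induction e' with | _ c d
  rw [Finset.mem_inter] at he he'
  change s(a, b) ∈ edges x.1 ∧ s(a, b) ∈ edges y.1 at he
  change s(c, d) ∈ edges x.1 ∧ s(c, d) ∈ edges y.1 at he'
  rw [mem_edges x.2, mem_edges y.2] at he he'
  refine ⟨a, c, by rw [he.1, he.2], by rw [he'.1, he'.2], fun hca => hne ?_, fun hca => hne ?_⟩
  · rw [← he.1, ← he'.1, hca]
  · rw [← he'.1, hca, x.2.1, he.1, Sym2.eq_swap]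

theorem exists_matrix_PM {r : ℝ} (h : ∃ M : Matrix (Fpf n) (Fpf n) ℝ, M.IsSymm ∧
      (∀ x y : Fpf n, AgreeTwice x.1 y.1 → M x y = 0) ∧
      (∀ x, ∑ y, M x y = r) ∧
      (∃ v : Fpf n → ℝ, v ≠ 0 ∧ M *ᵥ v = (-1 : ℝ) • v) ∧
      ∀ (μ : ℝ) (v : Fpf n → ℝ), v ≠ 0 → M *ᵥ v = μ • v → -1 ≤ μ) :
    ∃ M : Matrix (PM n) (PM n) ℝ, M.IsSymm ∧
      (∀ P Q : PM n, 2 ≤ (P.1 ∩ Q.1).card → M P Q = 0) ∧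
      (∀ P, ∑ Q, M P Q = r) ∧
      (∃ v : PM n → ℝ, v ≠ 0 ∧ M *ᵥ v = (-1 : ℝ) • v) ∧
      ∀ (μ : ℝ) (v : PM n → ℝ), v ≠ 0 → M *ᵥ v = μ • v → -1 ≤ μ := by
  obtain ⟨M, hsymm, hzero, hrow, ⟨v, hv, hMv⟩, hmin⟩ := h
  let e : PM n ≃ Fpf n := (Equiv.ofBijective toPM toPM_bijective).symm
  have he : ∀ P, toPM (e P) = P := (Equiv.ofBijective toPM toPM_bijective).apply_symm_apply
  refine ⟨M.submatrix e e, hsymm.submatrix e, fun P Q hPQ => ?_, fun P => ?_,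
    ⟨v ∘ e, fun h0 => hv ?_, ?_⟩, fun μ w hw hμ => hmin μ (w ∘ e.symm) (fun h0 => hw ?_) ?_⟩
  · rw [← he P, ← he Q] at hPQ
    exact hzero _ _ (agreeTwice_of_two_le hPQ)
  · rw [← hrow (e P)]
    exact Equiv.sum_comp e (M (e P))
  · funext x
    simpa using congrFun h0 (e.symm x)
  · rw [submatrix_mulVec_equiv, Function.comp_assoc, Equiv.self_comp_symm, Function.comp_id, hMv]
    rfl
  · funext P
    simpa using congrFun h0 (e P)
  · rw [submatrix_mulVec_equiv] at hμ
    funext x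
    simpa using congrFun hμ (e.symm x)

end Bridge

section Dot

theorem dot_nil_left (s : List ℕ) (v : List ℤ) : dot s [] v = 0 := by
  cases s <;> rfl

theorem dot_nil_right (s : List ℕ) (u : List ℤ) : dot s u [] = 0 := by
  cases s <;> cases u <;> rfl

theorem dot_cons (a : ℕ) (s : List ℕ) (u v : List ℤ) :
    dot (a :: s) u v = a * (u.headD 0 * v.headD 0) + dot s u.tail v.tail := by
  cases u with
  | nil => simp [dot_nil_left]
  | cons x u =>
    cases v with
    | nil => simp [dot_nil_right]
    | cons y v => rfl

theorem dot_comm (s : List ℕ) (u v : List ℤ) : dot s u v = dot s v u := by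
  induction s generalizing u v with
  | nil => rfl
  | cons a s ih => rw [dot_cons, dot_cons, ih, mul_comm (u.headD 0)]

theorem dot_nonneg {ι : Type} [Fintype ι] (s : List ℕ) (u : ι → List ℤ) (c : ι → ℝ) :
    0 ≤ ∑ i, ∑ j, (dot s (u i) (u j) : ℝ) * (c i * c j) := by
  induction s generalizing u with
  | nil => simp [dot]
  | cons a s ih =>
    have h : ∑ i, ∑ j, (dot (a :: s) (u i) (u j) : ℝ) * (c i * c j) =
        a * (∑ i, ((u i).headD 0 : ℝ) * c i) ^ 2 +
          ∑ i, ∑ j, (dot s (u i).tail (u j).tail : ℝ) * (c i * c j) := by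
      rw [pow_two, Finset.sum_mul_sum, Finset.mul_sum, ← Finset.sum_add_distrib]
      refine Finset.sum_congr rfl fun i _ => ?_
      rw [Finset.mul_sum, ← Finset.sum_add_distrib]
      refine Finset.sum_congr rfl fun j _ => ?_
      rw [dot_cons]
      push_cast
      ring
    rw [h]
    exact add_nonneg (by positivity) (ih _)

end Dot

theorem Cert.exists_matrix {C : Cert} (hO : C.checkOrbits = true) (hP : C.checkPairs = true)
    (hpos : C.pos = List.range C.n) {k : ℕ} (hk : 3 ≤ k) (hn : C.n = 2 * k) :
    ∃ M : Matrix (PM (2 * k)) (PM (2 * k)) ℝ,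
      M.IsSymm ∧
      (∀ P Q : PM (2 * k), 2 ≤ (P.1 ∩ Q.1).card → M P Q = 0) ∧
      (∀ P : PM (2 * k), ∑ Q : PM (2 * k), M P Q = (2 * k - 1 : ℝ) * (2 * k - 3 : ℝ) - 1) ∧
      (∃ x : PM (2 * k) → ℝ, x ≠ 0 ∧ M.mulVec x = (-1 : ℝ) • x) ∧
      (∀ (μ : ℝ) (x : PM (2 * k) → ℝ), x ≠ 0 → M.mulVec x = μ • x → -1 ≤ μ) := by
  have hr : (2 * k - 1 : ℝ) * (2 * k - 3 : ℝ) - 1 =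
      (((2 * k : ℕ) : ℝ) - 1) * (((2 * k : ℕ) : ℝ) - 3) - 1 := by
    push_cast
    ring
  rw [hr]
  obtain ⟨d, hd, htot, hsum⟩ := spec hO hP (by omega)
  obtain ⟨hA, -, hcl⟩ := checkOrbits_iff.1 hO
  have hitems : ∀ a ∈ C.items, isInv C.pos C.n a.2 = true := fun a ha => by
    simp only [items, List.mem_flatMap, List.mem_map] at ha
    obtain ⟨c, hc, F, hF, rfl⟩ := ha
    exact (hcl c hc).1 F hF
  rw [hpos, hn] at hA hsum
  simp only [hpos, hn] at hitems
  have hcomm : ∀ i j : Fin C.items.length,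
      (dot C.scale C.items[i].1 C.items[j].1 : ℝ) = dot C.scale C.items[j].1 C.items[i].1 :=
    fun i j => by rw [dot_comm]
  have hfpf : ∀ i : Fin C.items.length, IsFpf (fn (2 * k) C.items[i].2) :=
    fun i => isFpf_fn (hitems _ (List.getElem_mem _))
  have htotal : ∑ i : Fin C.items.length, ∑ j : Fin C.items.length,
      (dot C.scale C.items[i].1 C.items[j].1 : ℝ) =
        (((2 * k : ℕ) : ℝ) - 1) * (((2 * k : ℕ) : ℝ) - 3) * d := by
    simp only [← Fin.sum_univ_fun_getElem, hn] at htot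
    exact_mod_cast htot
  have hagree : ∀ x y : Fin (2 * k) → Fin (2 * k), AgreeTwice x y →
      ∑ i : Fin C.items.length, ∑ j : Fin C.items.length,
        (dot C.scale C.items[i].1 C.items[j].1 : ℝ) *
          kappa x y (fn (2 * k) C.items[i].2) (fn (2 * k) C.items[j].2) =
        d * kappa x y (fn (2 * k) C.base) (fn (2 * k) C.base) := by
    intro x y hxy
    have := hsum _ (adm_kappa hxy)
    simp only [← Fin.sum_univ_fun_getElem] at this
    exact_mod_cast this
  exact exists_matrix_PM (_root_.exists_matrix (n := 2 * k) (by omega) hcomm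
    (dot_nonneg C.scale fun i : Fin C.items.length => C.items[i].1)
    hfpf (isFpf_fn hA) (by exact_mod_cast hd) htotal hagree)

/-- The certificate for `K_6`. -/
def cert3 : Cert where
  n := 6
  pos := [0, 1, 2, 3, 4, 5]
  base := 139529217
  scale := [1]
  types := [(1057, 139529217)]
  gens := [(139495427, 139462753), (170950724, 167904354)]
  classes := [
    ⟨[1], [1117317, 3277893, 67146852, 36831394, 33623204, 100828228, 101875842, 139461699,
    139493474, 139529217, 102928385, 68162691, 35655843, 70390785, 2134117]⟩]

/-- The certificate for `K_8`. -/
def cert4 : Cert where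
  n := 8
  pos := [0, 1, 2, 3, 4, 5, 6, 7]
  base := 213814152193
  scale := [20, 1]
  types := [(33825, 213814152193), (2081, 143016397825)]
  gens := [(108481616966, 68924179620), (142843510887, 3429929122)]
  classes := [
    ⟨[2, 1], [175257096193, 2286983271, 213711454370, 108650528898, 68821359750, 213775451204,
    69932686531, 107447817217, 36510505189, 173107383492, 137513440358, 39931875555, 140667716677,
    4334881959]⟩,
    ⟨[-1, 4], [176334900225, 36646688995, 213677900869, 69894053060, 103147607174, 39933051106,
    2184321191, 175254996036, 68858977382, 213708246180, 74290568323, 137547121734, 173109416131,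
    139593816165, 37583261925, 4368405607, 107414257826, 108651581441, 140734829569, 1213271239,
    213776498818]⟩,
    ⟨[1, 2], [213814152193, 37720621282, 213676757093, 1176670407, 3289584775, 176334864482,
    174182111363, 139694610433, 104155287749, 1144132807, 38761824482, 213675740293, 138620862658,
    213742785667, 176334832707, 73020775525, 37648274660, 34499267814, 172036850758, 105260488868,
    74292796417, 103218906182, 71974460580, 74289552484, 103115100326, 143016397825, 139627337891,
    5573313607]⟩,
    ⟨[0, 3], [213777551361, 2249365639, 138520104133, 138587149507, 38728111331, 38661065957,
    34430129382, 104220300484, 69796502725, 107380704325, 73054297251, 108649481284, 68756315302,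
    39929842916, 71941954693, 174181095524, 174184339457, 105366394881, 72080366593, 213741769828,
    34462666982, 173110591682, 105227982981, 73121569793, 213814084675, 140701270178, 5571153031,
    175256043650, 172035706982, 5572169831, 3257077927, 143016362082, 172034690182, 36608055524,
    213745013761, 104292647106, 4402086983, 213710278819, 213814116450, 3360883783, 143016330307,
    137479916710]⟩]

/-- The certificate for `K_10`. -/
def cert5 : Cert where
  n := 10
  pos := [0, 1, 2, 3, 4, 5, 6, 7, 8, 9]
  base := 291584395512833
  scale := [1]
  types := [(1082401, 291584395512833), (66593, 219087495040001), (3105, 216751169145857)]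
  gens := [(325594122489058, 325493197963460), (325492188320771, 325630533048545)]
  classes := [
    ⟨[1], [76974543381607, 106866304913669, 211219115115592, 110123205035078, 4611796669545,
    148711104616549, 247701640845571, 183896845258753, 75905231758563, 5601981862089,
    37490776056101, 249902745785345, 41962067464483, 214414467010727, 107757710909575,
    70582520685704, 212352954958082, 113525789065410, 215548310916325, 35325106918696,
    3472717256841, 112193203115236, 73805799367877, 2236743885033, 111190536919041,
    216682442300516, 78340240319654, 177025975389447, 182630902628482, 248800040100036,
    40895876563234, 7975861388361, 74875448566785, 180390010559683, 175958672939240,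
    71643510809860, 219087423673475, 39584675305767, 246605414436968, 143150229233827,
    146238545790023, 252097669958790, 178258632024166, 179434372203588, 253205505246277,
    141940155979014, 140910605176008, 251001152143522, 43161401494820, 1173804424457,
    105626170858664, 213486956322817, 38551766179110, 6743139617961, 144075962712290,
    147411977804801]⟩,
    ⟨[1], [291371725493447, 291475841849508, 291442523315333, 291513597690947, 291584395512833,
    291546916225122, 291405044027622]⟩]

/-- The certificate for `K_12`. -/
def cert6 : Cert where
  n := 12
  pos := [0, 1, 2, 3, 4, 5, 6, 7, 8, 9, 10, 11]
  base := 372964453560421377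
  scale := [5125, 1648, 264, 3903]
  types := [(34636833, 372964453560421377), (2130977, 298727627476241409), (99361,
    296335229760637953), (4129, 294083223991946241), (67617, 298727556678487041)]
  gens := [(261537710941932612, 294187914785522819), (290740873690556580, 290740873690556580)]
  classes := [
    ⟨[1, -2, 1, 6], [5880500988347467, 45223050998779238, 298727486716386467, 254745128659495108,
    324649673980909706, 219593649479291173, 184718167520617576, 152103489230897410,
    78818536406002921, 372820315468960769, 109425606023029063]⟩,
    ⟨[-2, 2, -4, 5], [114982710767092808, 149786477989006631, 225261391539348707,
    289474137544758596, 255581861405073545, 372964379340085349, 329157775615787170,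
    182643484634786054, 80118461982059521, 10490544864334027, 36244379790384490]⟩,
    ⟨[1, 4, 7, 3], [152179358854876161, 226663268995829987, 36208090737286506, 10489410831424715,
    36320307294935402, 324650671293013162, 38531594830653798, 2503898559555787,
    332531147078893730, 182687293305301094, 10492917598851243, 372852229456271361,
    219552727168262377, 109353242203624776, 145353246837609799, 114912204479112424,
    147530276773634343, 372813780843796584, 255585155713142985, 296229671209833473,
    289438953244730691, 225226172807580967, 113863234084504647, 114844172293611657,
    253435614706573636, 372964453488039012, 328031878014894210, 187145995487937608,
    149992387311111430, 81251749232389347, 298727517882389700, 255871029540624517,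
    329149976156505160, 149787847009960226, 189232582942139622, 80116258660560134,
    184895287677092098, 329157774508333157, 372964343901556933, 82548142127688705,
    45258176145136995, 289579555402980676, 252415272111218826, 108302077041935434,
    41873810839899495, 6901748582286411, 372714796643061029, 220754733799842979,
    182502651580426500, 79942541089451145, 225261494486475877, 292851837242212514,
    254454861988505865, 78957212282924033, 5671392983093547]⟩,
    ⟨[1, 2, 5, 5], [333664609412222977, 288489076194054250, 259137687485710434, 46520517597987170,
    222093733098822657, 262690198646948934, 1417446823103819, 330278038676709571,
    372680845026296905, 372783988828576902, 43986309756429668, 188065212983679267,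
    180292695494823114, 331402711056683271, 112881435565988865, 46516152602599781,
    217479117128565058, 72310799679401066, 117351190842675201, 330278113834573825,
    372786393880233030, 372748738958140551, 44053379706724709, 112630741613255974,
    372744341822809351, 72171119827004618, 181274388652595529, 3590052642100491, 4718048496063723,
    146581436692179173, 146578206910294184, 75646547134852264, 153133487718897833,
    290635045672265957, 290670195978217607, 117351187451582628, 75688499294317732,
    218600618981566600, 154603643179631685, 4795010149059819, 331402848467162371,
    181277861131390281, 188168566003998915, 116008718348687652, 39483643177280868,
    221907915631795336, 153133596233860169, 77792785544293576, 3449344311502091,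
    256744039702074662, 217590236449997122, 262693505771536482, 295173803122659431,
    288383248207252714, 258996949762446627]⟩,
    ⟨[-1, 1, -2, -5], [225367013539942401, 72272042968493290, 1341517004510539, 39619949105586533,
    372678472219465865, 372821581343425605, 184690740933233958, 188097100966274307,
    80050289000099012, 45117573909620068, 221841944941174051, 36176312210099562,
    114882483436491047, 116110976093626369, 372749843708290151, 217412218547110210,
    181272298071925065, 372779659306505478, 75443269552909481, 333664535262009507,
    290740873690556580, 254632977602193542, 10488417752450123, 5921008971222219,
    258961765424071753, 288348098186747018, 298727627338846309, 256996932879155298,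
    331402882990604546, 77940299412941825, 117351185409999942, 330277903379144839,
    109503835726518596, 262689100208808131, 289544297150221639, 295138652882736355,
    255621446909629732, 219621034424607880, 149850454748333128, 153133422388251881,
    78989063825173608, 3625404646887691, 329153313178391553, 218715998683015397,
    154606839742562466, 112801175344356520, 146579203409750279, 182536626928593096,
    152035316087396645, 4579503789778155, 44090763403002210, 46519306450771302,
    372964312867838977, 324654173899624650, 180394985508608106]⟩,
    ⟨[1, -2, 1, 0], [255757782297681921, 289614970599118150, 333664433355292898,
    76745090518952961, 372920570669570309, 183770484051353734, 325780075918333252,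
    372964276392958179, 154605629870247111, 116143960466228296, 149821696720774371,
    150905954671594792, 255720399878554696, 150036060686030951, 118571507049140424,
    144157046939491626, 42925013515541864, 39410969084239209, 36138961932162410,
    216247595184596202, 8060864718704843, 10490580302862443, 372964380447539362,
    326905972573481126, 182645687956285441, 218672293231995139, 329156406594833575,
    114990510226374818, 372675211204534377, 1237164526702923, 224128104289018881,
    182437575312681255, 110480199913941254, 256707759005966505, 289474063396804933,
    291620384243258505, 225296575839376612, 73362928316984644, 10487250556264587,
    115133309263381573, 257838062620445833, 295103606108226628, 261290525776159875,
    293907368696155428, 225331897827329091, 77725581116189991, 9088667407852747,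
    80154751035157505, 36245513823293802, 372888451835534437, 40751484113158498,
    329155402881269954, 80230611865873509, 190630130939564294, 180356269594516746]⟩,
    ⟨[0, 3, 3, 3], [76773512163077381, 189373398811639938, 77906181263240292, 333664504284152900,
    295244480801475717, 256888084549862467, 114007300169367778, 333664396778804423,
    291866772629690369, 253503782382670152, 154602502026731622, 372708127829794088,
    150948938570179585, 332527845422206152, 183813060067394631, 118579305467188358,
    372851027931767012, 145493187810564419, 39653100950459752, 147668879763905736,
    154600167577917672, 144406596317025514, 328028333466260710, 1309795679344971,
    372922768755523778, 326903503205214311, 116259404619550886, 190631268037369857,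
    372674040756903177, 73332203002703174, 180181476239974698, 372885256608420099,
    256922170450578433, 296335229624386629, 293942442474054790, 81111148036042020,
    257973296116537603, 292746243524857033, 261325708878709829, 77978678164728963,
    226659008352685316, 186937947269111076, 38429311359789411, 372677480928054441,
    6863299798147243, 110344934010497193, 218568629805131943, 2290496535013675, 1199710202504523,
    224058834992272489, 180256178602021098, 108263626408038666, 220925192529158145,
    325778775552957765, 43075680997704034, 82546940545379431, 9159006158363755,
    295033202877301026, 252278931530589354, 218534716943673345, 41661809100591465,
    216283982314374218, 7958617451046027, 116042801875363013, 40643449747446119,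
    39552945738809698]⟩,
    ⟨[0, 2, 2, 1], [118572506472094981, 190635602726624387, 42968100819242340, 372923872632112195,
    324651912765967498, 224345807552414788, 257905125312701636, 290529631300233507,
    261360888992304294, 293872111317091401, 9123921669691531, 75475089860406565,
    216314734080922890, 181484299804217671, 8094958004248683, 109429042133172546,
    40539105463080297, 78922989747612901, 9194330209193099, 222052192172115012,
    326904778771671171, 259248737883327652, 298727556678419523, 293872043670150249,
    261360890133250242, 76852565431725255, 324647406141675786, 183740772542386177,
    372891956590810113, 372889517250707682, 40710620921962854, 73434495063371077,
    9264797502870667, 291796230109201478, 262686904307223720, 151162037600263331,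
    326904641197615332, 110522085566425284, 372921672365252771, 325777736443432262,
    8173016887526475, 190632229030074503, 219692399374703877, 76596591823334696,
    144186764992685322, 188236744307544168, 152213444755488866, 40602874050487656,
    150977319613537541, 76567833796062441, 117280646110740674, 5878303036579947,
    325775571741315398, 254745130845808641, 298727415846410407, 291760976751303846,
    254488945677740328, 146658531589761219, 330279036175784164, 219734387267535940,
    190629142022130824, 152288207184069699, 331407143628508388, 372926074735039619,
    109461094130884933, 325774403412664646, 73474867887025479, 118572435738302727,
    112768112954548423, 372820246782968034, 216215949826725162, 183596665658483713,
    7988297860421899, 73189132439072073, 45047132124812649, 5739487548446955, 144189028474037450,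
    224089621345243432, 183669097061751809, 42792178727130473, 372782860266143970,
    144191268332807274, 44015998652944744, 150876164811955305, 46513882917834088,
    3558233612813387, 216422692370519178, 217548592211300677, 4681934498209899,
    118572576467681538, 79104374834605223, 326904709955954689, 110557278365919233,
    372886184121213095, 372815908798963878, 110381351003597093, 184721253454849223,
    224196273980473602, 184654259480992873, 42897731775402341, 372747744613475329,
    72098489914502442, 45152716542218598, 257906226980135937, 288277829336045866,
    291655526908236070, 257901830005105768, 153239108682285250, 293872007159879913,
    261360892247217153]⟩]

/-- The certificate for `K_14`. -/
def cert7 : Cert where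
  n := 14
  pos := [0, 1, 2, 3, 4, 5, 6, 7, 8, 9, 10, 11, 12, 13]
  base := 458082801782478670849
  scale := [65969119881974289, 928011683961946, 41083129171966283, 357127460899932452,
    40405001788938822, 104580051017707609, 632599272732814255]
  types := [(1108378657, 458082801782478670849), (68191265, 382064291872278383617), (3179553,
    379614476611500444673), (132129, 377308422704360131585), (2163745, 382064219375377910785),
    (5153, 375002579420539063297), (100385, 379614476540702690305)]
  gens := [(272459240057533929602, 346177324391895007334), (2420865162882129324,
    37041163633913344237)]
  classes := [
    ⟨[1, 7, 21, 0, 8, 9, 3], [227273100777974211847, 79660800720968725833, 185766735938778802569,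
    151035146138673359115, 78402081975064409387, 188005057837996059943, 148841786436310377864,
    226045974436099894600]⟩,
    ⟨[-48, 0, -140, 30, -16, -84, -44], [340484977840242299905, 458002830002399413317,
    268676180229499130211, 122475683619247920129, 457998326401827117162, 268856324220869804194,
    340484976736463921286, 376191701386265755810, 369274172347989923948, 371580015355018522758,
    415530614225554807942, 11795219174908794989, 308270494346785194146, 458003955900483701956,
    340484980036239166660, 268820295413445758148, 308270423971571369029, 415530614196665323747,
    48688707325613052323, 415530614297401164869, 308270388788337087489]⟩,
    ⟨[5, -3, 9, -4, -1, 7, 5], [78513681136187979015, 188071516921765700936,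
    222589290266927377801, 79702489703992505640, 189188416021339678023, 224820894251033699659,
    222624368914168392071, 75087566823090369928, 189154563362916740361, 153417374319934418185,
    153339763090517108043, 227127827907230279979, 153448940094029670695, 77396612678470219017,
    185623814922333136267, 77391164424475522375, 226082954379329382665, 153414030804932439336,
    189085953737485427979, 151105907375149034825, 189189500344889354536, 74946833632920319371,
    148802491915877821831, 224966095756600944936]⟩,
    ⟨[3, -11, -37, 2, -16, -17, -11], [117778280439128432874, 117634168583846534506,
    110865325376638722284, 2527789373401084141, 37114275660644523436, 39379689693974376874,
    110902409706933231852, 113202626515080491242, 43991305278161427882, 110722336191512224108,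
    6959295227000824173, 43991269062995124650, 39415615138947183018, 6959331442167127405,
    2490705043106574573, 110721213521356823916, 2347715857980076397, 37115398330799923628,
    7102284412127322349, 113022552999659483498, 37115434545966226860, 2526630488079380717,
    37078350215671717292, 6958172556845423981]⟩,
    ⟨[24, 0, 70, -15, 8, 42, 22], [415530614264181265409, 308270318420796379427,
    159369171765533279301, 340484975642422546691, 458001704103629362177, 268784266618216842309,
    268748237822333654017, 457999452305019113795, 340484978938615104581, 340484981143035314338,
    458005081809755439266, 268712209021047843974, 340484974539625764968, 373885858367364334661,
    372732936863892247553, 268640151429195012203, 458000578199455705222, 415530614370444902562,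
    85582195467561907334, 370427093855881924995, 415530614159020431463, 233156148071131906210,
    308270353599698216070, 375038779870213639364, 308270283233139136617, 196262659911227346116,
    415530614329840831684, 308270459154088398020]⟩,
    ⟨[-22, 14, -28, 15, 8, -24, -16], [150061177643050774855, 221471307908989167916,
    43816721557693375915, 3604219088768213325, 189187425431156268298, 1372652387189464461,
    39312103675150053799, 73938026148161402092, 186812831194657665384, 117674555948004715785,
    153554770393526673706, 191386169482690176331, 221399319618510956908, 113136087537475301672,
    73974017630569477388, 154566922456161135849, 42664994120634966443, 3640111511041877325,
    222519589922840812939, 41615728970452806055, 77395696646872249576, 1228503247364631949,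
    115479051024571211017, 153410729900300872938, 116663531881251645736, 224860228180007854441,
    75160753413705446791, 189115229433944614250]⟩,
    ⟨[16, -10, -28, -6, -10, 16, 8], [117639794716193497447, 80740645320772597098,
    112013743384694268298, 40568571759208832426, 4833596098734235885, 36971389793204448684,
    43995770394882907560, 2348738404800573805, 37077223284969644460, 2527752093082890509,
    43955243495695097258, 7031387902333788397, 113166666985246208234, 110897909440133373260,
    223847059963543564522, 110901216736751035628, 5805354403244547437, 39421136886408950185,
    37078243698335326636, 7100068896196274413, 110722270151023435116, 112991027699191820523,
    147615825369729604972, 2346592122672755053, 7102215177254477101, 39415648158624264618,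
    184688224917594087660, 117634200538434675050]⟩,
    ⟨[48, 0, 140, -30, 16, 84, 44], [234483402607560004609, 48544591759580434855,
    415521325623169721669, 231782691815825609059, 122475427433038648616, 308269297838662583365,
    156879880397534538979, 48436505471602626987, 160696428506381587457, 415522416338704476453,
    335873290477652811910, 189367615828741101674, 259632705893678842242, 458002759324719580231,
    82230279333566755841, 194889203696525119843, 458002583574590719049, 192910638222842012673,
    264244251174718538018, 338179133418314637446, 153627049185896339562, 375867125553746289835,
    221687834871149406316, 371580013989218922631, 74118385877879141484, 375939112779040042153,
    371580007597233844360, 410918916112511048966, 1408792534285883789, 298758891933787357346,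
    457715717827758984395, 268812409723567541572, 340222645357945137348, 308265920238800143429,
    122475393348178187529, 83164961696732165347, 407460154897221197190, 3712383743685957965,
    299875784641376256162, 340187742460832984260, 457859828617791474888, 268818033727691099396]⟩,
    ⟨[24, 0, 70, -15, 8, 42, 22], [117782932507186338817, 406302587931519619308,
    2349899687723741549, 37266377767753158060, 2495110880685240525, 44104994780430507428,
    13120324964055130349, 11759044942919408749, 39456253327083319715, 295189683396030012780,
    7108161404853814349, 258295057632977002860, 39420257448573022629, 338995411997202584938,
    117638774678306070885, 332262530450133882092, 260596433326445965674, 110907127814338020428,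
    297634012059459170538, 44068991581425770915, 413214384108687626474, 120084204843332705418,
    113028114457317257574, 369129806230984071404, 117927148815871541474, 45180254822530720170,
    121273355326612480170, 457926117909482217706, 44141296325059936674, 39384092266310447526,
    368985658160535869804, 11723083282780299373, 9445293146626104461, 50008186944767532458,
    113280390572376764644, 110869767429383691468, 7290348179375066349, 37081656715570782636,
    113208401253293797377, 457746080609227513194, 10597395514777672877, 8111196656241910125]⟩,
    ⟨[24, 0, 70, -15, 8, 42, 22], [116591730537851693057, 261751466992888850793,
    187936696937341125707, 296303198506875922827, 41759810450584775075, 11614963972880510061,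
    369093810487968373004, 154819506802745737474, 155651196327929487659, 158169093040468371624,
    457781936816206884138, 191710746380362547522, 149989191783489581382, 369057644320645290284,
    186920819790385066278, 193805667838482291849, 412064735846035951849, 79559607301451232523,
    151221949653163844807, 226345328468276874535, 86902795597581006152, 222807792845553116548,
    300985816047803477319, 42917127804923422115, 11686918179475465325, 230587867820071394443,
    197584386867659417863, 149099552674963066249, 77539648177355240740, 78587824597266314441,
    185700442219841006984, 409762439863380349160, 115371255007529053185, 262905580368104334696,
    227244107893296170056, 229576623130156376393, 457817995402045400330, 84383246940499162279,
    333345646125084054919, 75052740995642144133, 336654666154232780107, 224896502305323887877]⟩,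
    ⟨[0, 4, 46, -4, 8, 12, 6], [117638704000626237799, 223702944912772444522,
    184688190832733594860, 39420011020764328361, 80740713490527040874, 184508081100002992492,
    7099963446157125933, 40568568563719610794, 112049736999421518218, 189295407336396202218,
    117782676320977067304, 2348773554814955885, 147651854132388834540, 39204051473072894379,
    147615723114074512748, 112992152499652047083, 110861881739505474892, 7028013501081037037,
    40496584531769695658, 4833595033582345485, 1336656642157388173, 73829871690425087340,
    43888707717834223017, 39384084508525769128, 221543468754143553772, 113028113091517657447,
    117602572983352075499, 153374803393296735594, 5985322468626406701, 5805353338092626285,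
    110897839140106577228, 43924876015393153447, 223847025878682087658, 43960867497738280360,
    36969140192346975660, 2492849194930581773, 37077152982799557036, 113208110982224064777,
    80848731608754468074, 112013745514999094666, 3676209511696571725, 4725615258646192365]⟩,
    ⟨[24, -20, -26, -10, -20, 8, 6], [39420186770893189543, 221401569219303481708,
    191421072379802297706, 116661282280461213994, 117638528250497376617, 74007831943458338028,
    186809456793471955306, 110898929855641332012, 43816789727415345579, 150060051777503670506,
    110867505743629032716, 2345395954952515949, 117782642236116606217, 73936935431586460908,
    39312137761050702247, 7098872730622371149, 42874411504381436330, 153554840693551440106,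
    43816720492540470699, 3499510397430800749, 1373777187586710925, 189115370036141497706,
    113208145067084525864, 154563650309556841706, 37080530582661996972, 6993110603968883949,
    113136263289684537576, 221402697215252929900, 2487225190807023949, 43816756707705789867,
    37004043089459128748, 3608722551057293549, 115472506730288946442, 1372618302296497549,
    73974019760873288940, 117674560208645827817, 113028106699532579176, 221399320683695352172,
    39384090900510847399, 1374833818292493709, 41613477239358594474, 3640247851557462349]⟩,
    ⟨[24, 0, 70, -15, 8, 42, 22], [343872819253153434625, 458042366274789579013,
    416676845413534597250, 377164375676280673382, 378281236395013276742, 345157466714280198466,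
    270121793925060499619, 343728699730354673665, 267805826610624794790, 382064247990597648642,
    458082801782406288484, 414376213127363628169, 412069524524121457731, 270085456164297909443,
    345165351037217868967, 230957233598575576132, 303544142518809662790, 457828416636465813637,
    379578440287621513314, 457972530834552426597, 305779088989407553537, 303228855363740832907,
    158323349185415512258, 458043501829813409956, 377308246772836011302, 194023353812738245702,
    417839653723577522307, 382064291834799095906, 457971127854693393508, 301175213899636740097,
    267850475579946209481, 86910723207209366692, 296673760449906546052, 262011909407169188037,
    336914756899080047617, 271379384539652755624, 341524193321974665217, 306762949515195657217,
    263239067737937417411, 409764773296460923972, 333490896346242157957, 84459816163566826693,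
    305897308097239717063, 229730107256701258885, 416681341385301951560, 457790067940784122981,
    414374241708249453699, 417839723033448678467, 271371442768243075235, 341273117601950762059,
    155978067929923128486, 379614476501978939586, 458082553356162865444, 307015291693402560513,
    378425281283228733542, 197592415769998852226]⟩,
    ⟨[18, -4, 40, -11, 1, 26, 14], [77430600609168766215, 1302740073517950349,
    226012026980199112041, 116524025741768568040, 41685395228806325674, 148945409738978666887,
    224825360433005601067, 187964697101527820648, 41512108865454611883, 1229595029092478349,
    74008818274139354412, 186918739249171018055, 221473695979561917708, 150099522049071722728,
    191457169312184511754, 110831372595952525612, 6957010476098463085, 42766259173763425706,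
    42876630215766092199, 227126770211403112779, 154672753817689497929, 149987922885834289450,
    110827043817600231692, 2453518459203825901, 191388489383507467531, 151219618732536373481,
    42660459766892243371, 3500497791183365485, 222626445960321277321, 78580146613080307015,
    75161840933817005448, 115364248950608932138, 115330642345460148584, 224861422215373399400,
    222590522647699041671, 41692147228780799399, 79771275083778438376, 116595944797343490281,
    116517271610416606474, 115330436769031563625, 74945671549022385547, 77430395033780368617,
    185627261757069467019, 3535508269678603501, 37112093164454521260, 2451263531580141901,
    73899778672974738700, 191424380741571911017, 186881412065280766250, 154492715454296269131,
    154671697187015206154, 150099386774748213543, 221510711072905208108, 186882707291052028232,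
    37008510337591647660, 6990822657675799885]⟩,
    ⟨[-40, 19, -28, 20, 14, -40, -20], [39384193156165939623, 74008922659025597676,
    1373709017832267149, 3500636263075422573, 41685532634473831850, 6994201319504653549,
    37115433480814305708, 113202521065041342762, 154671733402179510506, 43816754577400963499,
    39379587438319284650, 37112023929547172268, 3643625448201920749, 115328395940158938474,
    1374867903153970573, 39420118601138745767, 73971838328731088108, 2347645555809988973,
    117638531445986598249, 116661387730500362474, 43991234978134631850, 221402695084948103532,
    113028177001702666600, 37080531647813918124, 2525539772543611117, 117778279373976542474,
    113022482697489396074, 110718961790259472748, 2490602787451482349, 43816790792567266731,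
    150096079478131568874, 110865324311486831884, 2455802145961947373, 6957081841309654381,
    110867506808780923116, 117670197346505764074, 113208250517123674344, 221401572414792703340,
    2487327446462116173, 37006294820556479916, 6959297357305650541, 110830422479494095084,
    39307634298859139498, 37115400461104749996, 7098906815482863949, 43991304213009506730,
    110902304256894083372, 186809527095642042730, 6958169361356202349, 37114343830398967212,
    2526698657833824493, 191421142679829093738, 110721210325867602284, 6959261142140331373,
    42874376354367054250, 117782643301268496617]⟩,
    ⟨[8, -1, 32, -7, 3, 20, 10], [457929534126607899649, 10526462678488260845,
    118931271587696382218, 154743794638249034826, 37084119382169461164, 297675600097830777123,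
    196046409862652108132, 13119165005031546061, 9264128915580980589, 50013673566917371302,
    46301626518779238823, 232939794728832237922, 457891320666654777667, 8292363189530952781,
    47378295863250361770, 7209289982951101677, 113139651984185798885, 111053279222721584396,
    150060230992530190570, 413220045562852909057, 110904559561328726316, 187025629740941979850,
    295368771823089028332, 39423564814200615332, 406301355507741663436, 191421290083104394602,
    123794984083572302122, 117644509593741992292, 302101547816840242538, 116769720504501575882,
    374930406276841382116, 302250096167351262313, 2352362460619616621, 74045022166230250636,
    1374837322979512717, 372588640124630605825, 41829825936890207658, 6998745600893299949,
    113359191471031759080, 110975603129466657964, 334527844358309425386, 265177718955527151723,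
    110899141133666265228, 3499515997900379501, 1482074678333021581, 373597447471589760357,
    334569496164063817832, 37080636341930303916, 265244115164118428810, 115472513533517136970,
    118792714423356529000, 457896880794953318626, 121133746922046532838, 46333187012982707626,
    159332959015065133285, 47275836839344478635, 45148698835861930402, 457748229114140338534,
    119945648921313182050, 85509990195645396198, 123799455691132279017, 42874417173738098090,
    7105628336215565453, 221402878634666106220, 408607307205431046247, 370318758775555628419,
    3789042452638605549, 43820141004291612075, 37184193671455746476, 2678628174634725549,
    332083513490493611372, 260673067092241920001, 7099048824276259149, 221617742207374368940,
    39425992192114831783, 74007944093442946284, 117641906121910690153, 408602731241811488938,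
    339144028517467954435, 258404376580998825036, 2345501607923626349, 37010803986256991660,
    44183800077000940965, 2595317076033057101]⟩,
    ⟨[16, 1, 38, -8, 5, 22, 12], [372624601784769715201, 260564980701184700523,
    147831998461081027660, 2352362354322420077, 302250131351723318563, 408602731201210626250,
    110904594745699771532, 223847207298095263978, 413220045459773497447, 80956818343398257802,
    112013749019686113674, 4941963956177805549, 44183795679085501864, 36974775189271391660,
    2600946580768207021, 332083515694880267628, 7100174724182059149, 40568574164189189546,
    112158034490167828874, 373777484771844464869, 47347894431234928038, 9264128846693897581,
    159152921714810428773, 121061689330156083435, 457892377184588540134, 118792721026868740450,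
    457752732724505117026, 45148692232349718952, 4833601836810536013, 370282797115416519043,
    40676904433351007658, 112995536796237869291, 7208164083077654765, 111053284723333176492,
    2348879314083262829, 258332318986950421644, 339144027417956359272, 223919117900843331754,
    110898015233760465228, 334527842153922769130, 265285805346584371201, 457893572466468790273,
    8292359890989781261, 47414324659200662954, 113359195868947198181, 110969973624731508044,
    7034774397878899949, 37077258635770667436, 265316172758166832202, 334569497263575412995,
    406301355548342526124, 80740825640511649130, 117644509421847880039, 295368666269771539692,
    39425992364008944036, 13119024271737494829, 184688408536035691756, 39423388892177641897,
    6093760692666768589, 5805359007449288045, 374750368976586677604, 297675564913458720873,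
    37084119488466657708, 2678622674023133453, 37185319571329193388, 43964256192239541669,
    10490433882537959661, 118931274886237553738, 457927282326793887043, 233083942799280439522,
    123799526057728976102, 119945648709786048871, 85365842125197194598, 46301626730306372002,
    50013603200320674217, 196226447162906812644, 46333187081869790634, 123795124816866353354,
    117642082043933663588, 302101653370157731178, 184724254047473017036, 7105593151844520237,
    408607307308510457857, 147615902329101032812]⟩]

/-- The certificate for `K_16`. -/
def cert8 : Cert where
  n := 16
  pos := [0, 1, 2, 3, 4, 5, 6, 7, 8, 9, 10, 11, 12, 13, 14, 15]
  base := 547072003193943912156161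
  scale := [7166940243931520032464444716547374524659277464081993681463925825352,
    366070796278600970819090818734202139777627773581847194275689396798116,
    34988577618613887667839361903026879270935105934500295924684254747851,
    571492978179407026768163385264452078605186925892692545101913775348960,
    136661842969344411430929036517632568916951981269455444651506205077012,
    53747612030742301236518836888732978942621623882326157028210633038892,
    934471573408072163391437691115482303437673400149925042557283505674208,
    609961782448053232016890080456818491844995534015104753834243016615693,
    1807930246041439151399301169774875790187337750201274801741921235693212,
    469956496871598693205762537457827011410800862432800187738463678005801,
    1413713848496999205027941140642734629440701658238562210060409098980139]
  types := [(35468117025, 547072003193943912156161), (2182120481, 469229049045898818030593),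
    (101745697, 466720438218862208551937), (4228129, 464359039017950527949825), (69239841,
    469228974809072733850625), (164897, 461997855495317754022913), (3212321,
    466720438146365308079105), (6177, 459636672253539671673857), (133153, 464359039017879730195457),
    (101409, 466720438144028982184961), (2164769, 469228974809001936096257)]
  gens := [(1296105822234295612906, 41399285750531967328719), (316815136664692490050726,
    387582715087736296082567)]
  classes := [
    ⟨[-4444, -8340, -5896, 5648, -1808, 2052, -3812, 7504, -3416, 10736, -5048],
    [271725262265666242980136]⟩,
    ⟨[2587, -1019, -6154, 1774, -2344, 10603, -7313, 8776, -3178, 2188, -11282],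
    [504678071789094967644161, 355886418166125913182435, 314495421373455245809767,
    388872658676977761262787, 502314437677965566348484, 547029451006531942384708,
    546959085743408027926690, 431443376561931225890946, 463178483323699253515366,
    430120981083808503927809, 387650741959008277666950, 466646646813661387228229,
    352124581665777262926053, 316747109793420508466343]⟩,
    ⟨[-1550, -692, -6302, 776, -3582, 9766, -7906, 6658, -2100, -2030, -8738],
    [192697215114919444689161, 235048594332356419429708, 234978229069232504971690,
    2514564699279722854767, 151197626649523730560366, 118140124409632980972809,
    119462519887755702935946, 4766253119244985511343, 75669885284832754711950,
    154665790139485864273229, 40143724991601739971053, 76891802002802238307787,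
    190333581003790043393484, 43905561491950390227435]⟩,
    ⟨[-5146, -6958, -1376, 3700, -496, -2526, 846, 1448, -1666, 8748, 1236],
    [505863129854743901441025, 393664200379759430999171, 465465880713641713506405,
    352274317343989190105315, 502316672588181139361987, 504675762642053310383172,
    463215516388250782696518, 314382543222763473213607, 430084082143182889124002,
    425392850139646570763398, 316783969434202011636839, 547030602870306364358786,
    546955558301198910033060, 388830180726391875738820, 353304090170785364381925,
    313314862509387175496903, 387692102982801713831014, 546922193278905900729413,
    355887710698119458062562, 431444533845198461177857, 466720438218789129229313]⟩,
    ⟨[-4392, -6688, -668, 3040, -384, -3364, 1528, 1480, -1138, 8012, 2288],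
    [193882273180568378486025, 81683343705583908044171, 153485024039466190551405,
    40293460669813667150315, 190335815914005616406987, 192694905967877787428172,
    151234659714075259741518, 2401686548587950258607, 118103225469007366169002,
    113411993465471047808398, 4803112760026488681839, 235049746196130841403786,
    234974701627023387078060, 76849324052216352783820, 154739581544613606274313,
    119463677171022938222857, 43906854023943935107562, 234941336604730377774413,
    75711246308626190876014, 1334005835211652541903, 41323233496609841426925]⟩,
    ⟨[1456, 3158, 3610, -2638, 1250, -1976, 2644, -4042, 1810, -4554, 3598],
    [276669363732362463188993, 460780358247506225670307, 503495933312746363656328,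
    278820529559044454614083, 501137366291057967507750, 318100385080898132214855,
    498768011615559997227106, 546987769874221746885923, 427568413755514997152036,
    464174385802554434224322, 347472218008528995325156, 546810255205158856200296,
    547071740859265618126849, 280326273227843384158308, 469229048789641811004712,
    385070467456681458670593, 392267831908865105304869, 271841970073631124950149,
    391113001285934033083560, 426493877860917385078981, 349644572075171986345190,
    309732844149481750565159, 277897254162976340115746, 275459912120542466020552,
    423110060971178583098440, 274240948685307633832102, 315413313559494252505223,
    354599926639874900404456]⟩,
    ⟨[1448, 2534, 706, -1262, 514, -1624, 756, -1890, 1146, -3218, 1670],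
    [163336026907901722531841, 456057996268231912863907, 503495825229653841549451,
    203336452809356317033539, 501137365200342432752966, 318099268188190543316039,
    496409134217132242927714, 546984311215261039465859, 427420839943662674876836,
    123125365348529624027302, 416026511253464742593614, 11007389087298397279439,
    354599924390274109972714, 315302636472751615063175, 464100670883853566902466,
    343930551232764597179620, 546625787769919151050861, 547071705956368505973761,
    91431619542385311136868, 469229048755556950543625, 383926769324110426283009,
    392267759921639811489125, 235243629831358088547461, 391108389604313648012460,
    303829886221811185783239, 349608831508529141583078, 426491574269707982975173,
    51223663196133443961314]⟩,
    ⟨[-32, -3338, -366, 634, 346, -1384, 716, -1146, -722, 3390, 1790], [271725262521852452251649,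
    546803109892506322839848, 271725269032060800303394, 271909742091301944661288,
    422841422062646800394536, 271872836640467981805736, 271731027260217358657672,
    278820341205006035560744, 274086445522479195990310, 271725270463624939668552,
    498767788324539605559592, 271725442421745965345059, 276447642259321885399336,
    460632603716624764479784, 271729873964878797318436, 271732191053692941996328,
    277628616686008696777000, 271946983482520611498280, 271725524600344537009448,
    271835942744401715243301, 385062072490789840461096, 309504194144600683030823,
    347283126483680739305704, 275267037585201355401416, 271993892976239328995624,
    271733656975371651918120, 280321445004004995475752, 271725478790292077324392]⟩,
    ⟨[644, 258, 658, -638, 450, 732, 776, -314, 258, -554, 486], [157248192661923567053825,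
    383913690689373129186668, 303489442237479891908039, 343705716891672705966314,
    235235226923693982921061, 235091443757343795383561, 91425674391754473094409,
    6137434718841016034639, 203336190218491813732714, 122935120528342806668614,
    189156527103515372684366, 496408801752303794398539, 191515545033822807538051,
    162966623539916300360107, 455836526784564723890441, 235021901848109162706059,
    116030279642795274123436, 152710686480788515627466, 50839736950802778109420,
    10738496042047017234639, 38236717388785480183278, 114529182354004662260173,
    79145979691804003876260, 546615148895408798117261, 80287480271166544854125,
    3912093623332770354575, 42619085748089282527714, 415607994941871235510702]⟩,
    ⟨[84, 3320, 268, -616, -400, 1688, -820, 1300, 644, -3316, -2028], [235126922023393206577448,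
    271725190278440949164392, 271614585178923605538088, 271725260016065452548394,
    120609678928888233175336, 264641712547952402475310, 269366384867238488680744,
    271721803606705535560072, 271577688453813920704936, 267002900286391930173736,
    271725154182573720873259, 196241185515978105399592, 271725261174950708225352,
    271724145372958654081320, 271689521699023398218024, 271722958674456840876328,
    271720650584045857909036, 158391925441205502322984, 271725262231581382519049,
    270581564133095210592552, 271725227362769130827048, 271651547346965375658280,
    268183595489901844834600, 265822304337995678198216, 45051671298823346825704,
    7272739232422174239023, 82830608580208169958696, 271540794830426537830701]⟩,
    ⟨[-1072, -4000, -4000, 1488, -2000, 3836, -4000, 4000, -2000, 2984, -3760],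
    [157248192405737357782312, 266929185333606202390793, 158244243546260657940907,
    191515364877743085173128, 269366275693430431819083, 189156518905556675995950,
    6129040009135607096655, 196241111279152021152106, 235016136853558047028523,
    115882705267993535297836, 264491835144890678096302, 120573937271529853658440,
    265710510358545451857352, 42619078981694725204456, 3727613797697068673423,
    152488965263934147109322, 44936382530460324312556, 235124546444958510657896,
    270576880464249531705708, 235091181422665501354249, 82829491653415720598793,
    80287263746540710509869, 271537301268568718257549, 79141367992591449537960,
    114522253565977963243981, 268147852673658209640746, 7196720722511904813359,
    37968086678212394167790]⟩,
    ⟨[1404, 984, -848, -94, 204, 1776, -624, 664, -184, -548, -1516], [235091146519768389201161,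
    81682226778791458684268, 234940079009718805508461, 41474261706815313486314,
    1257987325301383116239, 42619076732093934772714, 3616936710954431231375,
    113376251808112668291502, 113490387553816013153614, 189156517814841141241166,
    193882198943742294238539, 191515256794650563066251, 153521881566986345134507,
    115735131456141213022636, 152415250345233279787466, 41394715754695926167020,
    1293762794841340031439, 79136756310971064466860, 114519949974768561140173,
    37932346111569549405678, 80287191759315416694125, 234938961026295681854861,
    157248192371652497321225, 153595848509145461733641, 235012678194597339608459,
    193882233880724266852714, 6127923116428018197839, 81685793520844688211209]⟩,
    ⟨[2648, 2716, -1464, -800, -868, 4772, -3312, 2620, -514, -2976, -4948],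
    [193882570708414854401025, 393654688487075363429771, 304642653063179456887207,
    342829287131886990407915, 199789781540447394730187, 202149150544817578779972,
    546912672387818671449413, 346138318224796675342562, 421704652684017606562057,
    164479759653098797339913, 153780460465292496124005, 546651186733711909522860,
    235345191347681424998786, 307329724584583336596839, 377942998731058989538414,
    129203558332203792838657, 456980260110303938163713, 379090011343630962695620,
    41627613789821119959525, 1638674350002989501903, 53656246497266717827562,
    14257357609645163721839, 85460350560368915168614, 313010193994595838536903,
    352999709877574085849325, 86589493434977265827020, 235279073194510387588260,
    546735157718755780763786, 127557190822770260804002, 113716374031361210029198,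
    453770774125049757738318, 12141576708171966585007, 420630116789419994489002,
    425088469573756408542598, 160679401977276284699718, 495221518065113519031372,
    234950857495817607054413, 505862832326897425526025, 81692855598267975613571,
    465170444287815407933805, 49738490881915866847715, 492862706961739361038787]⟩,
    ⟨[406, 1450, 1476, -1000, 400, -1354, 934, -1864, 776, -2000, 1556],
    [546959085743369573568513, 431443376561963243078725, 387650741958943791189159,
    316747109793484994944134, 430120981083737566615781, 463178483323601671950563,
    314495421373628215922689, 388872658677048496292933, 502314437677828969470181,
    547029451006358098809059, 502314437677929972405350, 388872658677015276393473,
    387650741958975966812389, 316747109793456105459939, 314495421373561609355394,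
    463178483323775451529378, 430120981083914831561796, 504678071788988531907718,
    466646646813590652198083, 352124581665913859804356, 355886418166090316188839,
    431443376561824862345319, 546959085743331829912678, 547029451006425614750721,
    387650741959114713403393, 316747109793556841301061, 502314437677901109493890,
    388872658677121540030626, 314495421373666734277700, 463178483323734847458500,
    430120981083770988797123, 352124581665809573780614, 466646646813525054393511,
    431443376561995682745540, 355886418166223494747238, 547029451006320453916775,
    546959085743264249158851, 504678071788921997531239, 355886418166299756758084,
    504678071789133422002338, 466646646813629370040450, 352124581665848200238081]⟩,
    ⟨[1759, 1648, 259, -473, 115, 1121, -613, 387, -43, -1117, -1563], [80396892587414969040201,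
    226751021813852191208718, 121748552758575899320684, 157058101172891322462634,
    2583880864520984672655, 76746673472991929908685, 43689063150008823784941,
    77000384847653415304650, 42509446698279725444589, 191366563806265551010156,
    230258028717522008090027, 114781557107388233261513, 159606995567405534847307,
    189117249839907643633038, 37859788544344256165358, 2479034709009927420239,
    192481470320967725559210, 231435345020712313434537, 115846929764335301933449,
    3771246952513114939759, 227933986694203024127434, 46156209267205165461993,
    3696454440879115412751, 6163557917915247620463, 80320588344150595091883,
    118060501970981598242189, 151375354519426711232910, 157092726073982455133516,
    197232738613834959598860, 83939607745521334533387, 79105662294794272455949,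
    152377027207678827771339, 43792649392700119231980, 151156159860340608609710,
    118280596436231232400716, 192437739308589105226125, 8414238619016348578127,
    38039679132791799591406, 114746824293698603820491, 229296529263881273882985,
    232732229787345155794282, 191407127687497143171338]⟩,
    ⟨[-79, 1784, 2257, -1061, 865, -3237, 2309, -2935, 1383, -2179, 3355],
    [79254311347553603894601, 226786727477597858869518, 121680524762503646262634,
    228002014690275277185484, 154881205298579224605034, 79248624425025949613449,
    152299857958824700161485, 6014870553536504442255, 231508952026744827064587,
    154916981893085974179210, 4834458902050363581839, 42578552150806248175083,
    6162442115923195506063, 42722914930248676353516, 46120503603459497801193,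
    4839035680740480558351, 79359190258851585146250, 230365247145303743082827,
    190226542612173525754313, 159607030436217786475882, 229293178688013094664460,
    119321612461112272860491, 189007688657442877911406, 152303314538578884963789,
    115703967634103624775949, 5948142826825212797359, 40361659703684599462380,
    83866000739488820903337, 188939842947308462612910, 115705077777941162080589,
    75601824737688603082158, 189118365641899695747438, 232732194918532904165707,
    197236089189703138817385, 152517937906568786093516, 115962142182711850678538,
    8307020191234613585327, 40398554281614472690156, 42583159367379668252139,
    190078933897390935384525, 119246744655991379832141, 75602975374507838356910]⟩,
    ⟨[1146, 4386, 2012, -1948, 484, -1474, 954, -2236, 1710, -5304, 1496],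
    [275271911619094353481729, 388872478520868038086888, 309773041379833826912485,
    316599535418828146213154, 387644976964496991158562, 309652030854183828820993,
    546950691033525418039525, 547029442808500137961765, 385289558702264016737384,
    280327216764949465764865, 546959078976908409677960, 278968177914484020516968,
    274313931733885791512771, 504678071532840949093672, 277739305362699711452262,
    347402201672087396984935, 355886238010076191628488, 277635545730219455352004,
    466646638615775798274340, 352116186956249054937250, 347290235427855879340162,
    316746847458910986938564, 387429020742298863240260, 462994003498033486211073,
    279004821286829149225090, 460817300066817608424584, 423025902144365598411943,
    431437611567340281044262, 546811511368396912528679, 546807729789532619775110,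
    429936501258202867869798, 431443369795641729493160, 276716489494522853657768,
    276566717447766187970851, 466535966334821757753576, 275535848451853052455046,
    502314175343118499817639, 422847193823523754741987, 430120980827690103935272,
    274271141872743886292037, 502309825978793680077896, 271951603379691798528162,
    314495204848964637922598, 388604027966337029544039, 498772662358327279230243,
    498774717368717924467781, 355879489378234539386881, 547024839307278719978696,
    271881238116568012063812, 463178266798938192714023, 314226790662949805497539,
    385330883357545823538468, 460743292393353522810881, 504671143000932943407331,
    280328553948107995486501, 352013901187145947874376]⟩,
    ⟨[1352, -144, 828, -952, 880, -772, 1512, -1832, 470, -468, 2216], [199787834869406215901185,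
    388872370437775515980011, 305050679400559514106085, 316451961606975823937954,
    387641518305536283738498, 307293153455756074521601, 378206008984550176232558,
    547029441717784603206981, 546949574140817829140709, 421703495690952722354403,
    502314140440221387664551, 86641194766394979433606, 430120980793605243474185,
    160937805048283145634885, 502305214297173295006796, 235353263137418762125474,
    314495132861739344106854, 388568287399694184781927, 355877185787025137283073,
    49893126480923291816419, 492869704430656714448323, 547020227625658334907596,
    164405968538238970795110, 342679839692813084178535, 355886129926983669521611,
    202151468980531317771460, 466646637525060263519556, 453733750349103767919758,
    12263966461278784916655, 431443367546040939061418, 127889237950051139420290,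
    462883326411290848769025, 387355305823597995918404, 495233050592953526322245,
    466351498899582052604141, 316746812556013874785476, 346146537295284846952578,
    352115070063541466038434, 420667024745937844112551, 431434152908379573624198,
    546663937556544590253479, 546734014870831752453254, 429825824171460230427750,
    129211633428171455960065, 546959076727307619246218, 14515654881239951775855,
    85419278048427718491331, 504678071498756088632585, 235282897874294975661124,
    463178194811712898898279, 314191050096306960735427, 504668839409723541303523,
    457201625617589124665345, 351829433751906242724941, 53654962981265099332069,
    379427925429875258756548]⟩,
    ⟨[316, -524, 748, 980, 898, -1724, 1472, -368, -236, 2756, 496], [192697215149004305150248,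
    45049259624521422615019, 40144841884309328869869, 154665791230201399028013,
    82753435002546595216776, 7125130517672739810735, 75673343943793462132014,
    267999126963946604930381, 44866086970876052777453, 4913826931097307786543,
    270578103224533712740746, 234978231318833295403432, 118250801496375618414857,
    75743600203533622033806, 4766288022142097664431, 264564538970290827733390,
    269218776152489054252456, 266817315958444636125485, 154850257574725569422664,
    190333615906687155546572, 265786455688260311329227, 266967087732523791595880,
    158281176367237571065192, 120499001808060735272201, 119465978546716410356010,
    264530963473984471217518, 118140124443717841433896, 120606218020326735323530,
    151197698636749024376110, 271646934574629455832396, 190338192685410428464584,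
    43907865083159792331243, 196238881890683842834697, 82794759930472803089707,
    2550305265922567616879, 234979345961940093870506, 235048595423071954184492,
    265817657753478180974028, 43905669575042912334312, 268181291864607582269705,
    76891910085894760414664, 7236926678554035661167, 235125802881084827246890,
    235122309251057286751564, 151308303736266368002414, 269255707746410990777609,
    119462522137356493367688, 271576569311505541374378, 2514636686505016670511,
    76927542569445083069899, 196236538931460608175404, 235053206013976804500808,
    192699518706128846792969, 270579152458793286381867, 40328192426841445120488,
    158207456915250262418765]⟩,
    ⟨[1028, 4796, 5192, -3952, 1808, -5852, 4564, -7632, 3424, -7712, 7848],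
    [118319944169707136332072, 264601432525509533903246, 266968237346699468945768,
    270357937896893441126701, 153665054443808511899976, 193654029843081617320364,
    120605970427831627784587, 151195393920604004791598, 271646898649186465915212,
    197274166205359766023496, 192662409291354627057931, 76927541342322460769739,
    46047799914400938566125, 7162204143311263184143, 81576366223709669080362,
    267998951324657494992237, 7234620974117512685935, 43831885941293490483688,
    265820107500571385475529, 230223618926223580145965, 82760206164655032679784,
    120461928182422211898793, 113562956266800203407662, 264531139113273581155662,
    192517395423015010252072, 265749562133041605159371, 41513395557758502643176,
    1445874085747635890639, 45049507217016530153962, 229076387931848484174250,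
    2550306493045189917039, 196125862969415392570668, 158459946654424777470281,
    226859327582802016576910, 231583955966629958266154, 269397517092578218320265,
    158274405205129133602184, 159490767727049773066540, 268178842117514377768204,
    76965693719644182265288, 44868392675312575752685, 8455673845552176767279,
    270436293878366485198090, 232617156128502244059560, 118251738250625734388073,
    2516941402650036255023, 271576605236948531291562, 228117232494027466941896,
    82905435892518018694443, 195986392151509327783181, 84006581871788892208460,
    151307366982016252029198, 121823597327687544711560, 269217626538313376902568,
    267038530520344481380651, 43944974497934012066281]⟩,
    ⟨[1008, 364, -440, -414, -224, 1660, -992, 520, -256, -764, -1260], [229151371523174998391080,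
    268038255293041435158953, 114708852259341435645384, 38008473727226395077102,
    7276160909446712962383, 197382575558170398535978, 230404698496723302424905,
    190153765572456663594441, 4949746511531380844847, 266999470872239352887690,
    159423793600779194312104, 120678782268291883182348, 75750622332472889982254,
    191260673835889051646253, 82646206656036011785549, 75820843757517708573966,
    119394247469044873013547, 264640492173610599194990, 231477924476081265816904,
    196090296883207635118473, 265859159513664588099018, 3804719819335699737903,
    44977781695246875665899, 45124271506384931401192, 265780803532190435878348,
    154844283521160619438379, 4909254856116994945295, 46231001881025194633707,
    190231113869184833202632, 271615664885048495322473, 232834916326199303446828,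
    158383784101722637804908, 157019949068317168609677, 80466106361798828834184,
    269178566890214421571853, 83973224723100764355880, 270396989909983553724843,
    119318195385579329795432, 271685958297286429946123, 154921559830695673014632,
    270467535277512225891720, 269248860063855242720556, 158202993809502338687277,
    82790248594612799520138, 226788921792710228486510, 264570198761374646447406,
    268218146085898317934920, 196017556109750095393192, 266819580317978702756173,
    228038796856100297910732, 40331612672132196448745, 7126323930960879788463,
    120502346896300674889002, 40366345656318973753832, 8305829027612828412335,
    121790232305392553534730]⟩,
    ⟨[-893, 3845, 5690, -2648, 1952, -8277, 5667, -7652, 3388, -5328, 8778],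
    [505863014937298731076609, 393656021661660614766723, 465318198351551670559845,
    87367542913822128225517, 306966939509436275038381, 421804947185975286890882,
    75967628428741210160270, 458087096280155569722701, 199927437443685786393988,
    157325376271140468761835, 353259119463931950010629, 80738312898203837807815,
    380262676799624769354118, 154707520771598799282597, 129214116876056465473762,
    302608547122788014533742, 546845911369068985876802, 240930771637212917511337,
    425131129780742313645193, 14404682495200924511407, 425242955391012739257482,
    462034920006991856567366, 238817365636774976692583, 114675626120477582794186,
    3581347157724948279727, 457312555812068403905606, 49923895275585973399015,
    37900281789298053127662, 114591547150299816244684, 393659552444255881404547,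
    465244339492516279661669, 546731891136853619156132, 378056885519112534666446,
    312900598898018908966315, 191562677316764757604585, 353226832034471308693829,
    191713925176371462846663, 237710978737570442386756, 190416660286860088643018,
    53650055216361434747371, 453622771419304180258158, 119646059525218659443852,
    546876006460337982677156, 386210274271763738305739, 313115077200873826356588,
    242550910246118888833250, 40263920540503756945893, 492868261160354333273540,
    48637232658902622940643, 341648840754757373008323, 3843013161389439523151,
    202252927019314517946369, 420376487359397459407873, 342372984677476500388237,
    165336189320156224492967, 9902629858663231167599, 546917355111295092917322,
    239780511762253789693001, 495227352134444860772553, 12029887089738891178223,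
    310656284805912774088874, 236192157649063816377708, 157398047820442217193830,
    424168438515828091388162, 80659736587898944994566, 85003976286425738034573,
    505862977750615004875777, 546909255457629925409868, 164111966657097097348173,
    86342521657452345179395, 499946154359197597380868, 497582766511013333635276,
    346371095775666744858979, 38077868822784713824750, 126699674943138798478337,
    546661342599499572478370, 5063812988923308739919, 204760228603948720951690,
    161018176110974519516267, 127667941293845628032263, 348313736989239529320875,
    419380363072901949628417, 379052109215526972306886, 304967604489242598750313]⟩,
    ⟨[4000, 2572, -636, -1752, 12, 4000, -1800, 788, -44, -3444, -2732],
    [505862945063299387034625, 546916243672131926361161, 236576178287399417191530,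
    313079546051548188577162, 5029129361741395995887, 353109240799625298219397,
    382594964564423976596681, 546696150604428811220132, 423955155535046556165121,
    240033011869754299129857, 546771913852683807785314, 308505668631523831623787,
    381591995288011192873222, 155115584900046624597191, 341449314408370040614348,
    546914841011916719129675, 198797322809709965646953, 52183862294628570240487,
    2773253716902279428239, 417087196888394302226882, 40519585459107884415462,
    9488626540994865835439, 126554392274960274392138, 491687880969123795341518,
    125223720306484937471209, 237347496588348501270947, 494046510911327230441828,
    76899154269791419907525, 204771977293539460841698, 312865067748826415172941,
    75864734655992820874478, 353041213928288953897381, 380159886506525140891853,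
    88919590297212407790593, 546882772202887145750786, 165299193062962247214253,
    425016989672140426318989, 89888687257590825204907, 425271781911910812030092,
    310864725998184372937836, 166993047579026785599714, 15870007586594511622511,
    44023159706312603930091, 48814019211468474818020, 454692649924378959746507,
    465428734838414451453029, 546837960086836696330404, 192845045782338663297161,
    419450679219706506182978, 302355257889089752832174, 393660525191988620831875,
    465392021421619936272485, 461665655418267335071146, 242537972642508324442444,
    151457034346293829373294, 124375340571600880114948, 119697836345594689855687,
    386094153764634801611174, 418089090957883672410113, 340092289768616403023214,
    240967837768374058128711, 190454649231525802126790, 47447342101077731488235,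
    505862908013023755045889, 154668168398179799604557, 190370726879017305446860,
    348732419751497443580227, 201035155152185383334151, 459673735779123441435718,
    40143946833321886366189, 393661822121065495667843, 306044603185497534568617,
    238590491924848165954796, 499947405069065143062730, 13143816430005802796111,
    161826418268581074580835, 345190721447137233606915, 119536379179777480169866,
    4769928307015795678639, 87697170618506475093383, 458493142966500902372422,
    75670070076277269118350, 118146074016406955341061, 497583890254848738926980]⟩,
    ⟨[609, 2175, 2214, -1500, 600, -2031, 1401, -2796, 1164, -3000, 2334],
    [431439914236313052909569, 115711102471393009711341, 302276746883147304867246,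
    380608408889528381651046, 546659110991189251334565, 499953065918976621741129,
    502310830282752120590595, 6360960792576485791983, 48625909491236082094572,
    152305625000489243585997, 79507098744132176657798, 420412222470292431607046,
    423910187028994343711913, 238640211689988651524263, 129207048553440533257354,
    453659774088817994143854, 352040022072829150245219, 497594089678679874481347,
    239773600202474765332740, 79259043509145085361353, 504674602816962187035716,
    462809433354361965282381, 85378643898348827032713, 429973395729464679530658,
    314044376723157219945645, 87821649864852220427491, 457054150772871744919877,
    377902610314597884145806, 127594195803394904929281, 236524626638064818881612,
    310833438752699099257194, 379128130011292930941379, 495223970102582924750849,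
    546737722345126669747269, 387315926137558111663211, 316562528179780425127017,
    160792234106513681257834, 241189023124046665187586, 119656428282707431620930,
    189265950996276773597550, 237455714720586398866763, 546881542521175055338666,
    546835542611580213699724, 165667989559796934159463, 355875999082139956150658,
    154965764891704640865354, 9556897768759618870671, 307411539297914727763147,
    202180284985267466932457, 164335643411323515315429, 388674140000291146345860,
    4842643075994529211567, 49662434226482999342565, 458456044456924565152769,
    547023683964828879552642, 6236233951711531871631, 42846458061865028491751,
    341194733803727280806349, 12107060740069365163119, 466609747442341924606977,
    42586628339445841245675, 190411124226023015981508, 386465538288747781825732,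
    304851265357486895708364, 348324541117049017205154, 40435453653007012608492,
    14220354805757028404655, 53653693136360783748579, 492860366284203642392012,
    461702451017990854063462, 421848769104941275193478, 116073017603307801655559,
    152754359188943380159942, 419369973416995668300170, 242540106118309400948971,
    199977737019758393494887, 346216564894288262140235, 342641511795429240682757,
    86227372498308019010983, 189310182962507174714574, 126330726766369803048269,
    75605287063411903085998, 546953061049782398684484, 204770618259855002279937]⟩,
    ⟨[-548, 1560, 2476, -1074, 876, -3800, 2600, -3360, 1500, -2164, 4000],
    [235060136148905247543297, 466388382075514105569706, 2777863464553345628303,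
    90073153811257179258027, 200971960185254296295689, 166988287244908442428739,
    494044309708743913125889, 459488805698919906673739, 198608098864445061934214,
    429752032476031353070925, 75903027947001477217454, 125600689599032101148937,
    459489119859078776004714, 15874652062414930259087, 51962545137601728286189,
    77046725840978486377925, 381789036391513667869961, 308358408945446082883687,
    355874662637501994577132, 161749495660179203624141, 88841184820325388598661,
    13035448628939004776879, 40555642235615956875748, 546948272593006137454763,
    192705290501159380254850, 316525557074524073534791, 340097294388929670296814,
    124420082709395641180362, 124045388860893262492868, 546696972517750945920356,
    546767304105032741585250, 235310285212507528631297, 382924916275131594218761,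
    151456212432971694673070, 125439280742318640437637, 382555801436589486251427,
    491681042282543351664014, 5135591248807485146191, 47596217488564412618214,
    416902730334727948173762, 417118332278991552222668, 47632272181281266250214,
    306107798152428621607079, 381341703274336852843661, 89851972857033304488961,
    462846178258688283061670, 417940357642683898116237, 52331121980706318980587,
    198600281706207490650214, 431432992028649633064268, 190346629064407506878914,
    546767269440729652659275, 494049966057252553275748, 161823203830077699667139,
    351927179877015129331948, 234986457155647305683363, 504667681836320561504650,
    118361490207154647827525, 387274565043042882297254, 418083319772915852097537,
    454914017531497379272139, 200959170352639197091948, 235395731799330480203075,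
    491691095407627170255214, 13140361284080479962191, 502308444501766338650314,
    344813752154590069929187, 314149400560594750708103, 154997839806637400326306,
    547022527484066428793097, 235307006692034357531756, 235395767008991336505450,
    15875778771562331935087, 43912847200143162805732, 454840291364792559807941,
    88698222690093988264961, 388418263482377658834125, 306231156988693836145991,
    340132790635292730495214, 345034894661091345116389, 308357299687747237252487,
    166988042958713518326114, 546700827481384233874697, 119470600693488451814468]⟩,
    ⟨[812, 2900, 2952, -2000, 800, -2708, 1868, -3728, 1552, -4000, 3112],
    [161859992608435378493441, 547071705666026638486793, 81691738671475529497601,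
    391972612007805290058093, 47377376323674970456546, 303820653842678063280581,
    381663368408172469884140, 234948481917382912151661, 52368469205415676289514,
    123116132969294563094725, 305857615276679121810660, 303534450086393394135490,
    390813241417692872939948, 235234406177846332495235, 345145968052644136132714,
    546689154302672247141767, 496408845705177800678757, 383917257721628708963399,
    349608534271133050285057, 90036296011059409763684, 459489167884578442059017,
    235395518087255251299461, 464100661867758360109290, 125189096809901962269094,
    417976097970767086500259, 494051083256689331550379, 153817317992812717979649,
    163336026617633974586633, 91422396161550056635564, 1562655840092752613839,
    415722139976180092177646, 318099258899682775409990, 198610762391785230574915,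
    200969222421094494110795, 456057708029094223165579, 203336164570181919840395,
    203336443520677787608390, 501127853597762971379015, 340164098534071067706446,
    1598431309632644453839, 88876925693734292601964, 546616555390573528461517,
    41699096047907277046242, 426196426355842327031917, 41778642000026519672292,
    454655937636510445507015, 546767334678973260311782, 308359387317349477915649,
    382813803583975578698082, 315293412819450245166467, 122830217161877708315044,
    113680632374002934318158, 13071181560570960819407, 354304488254818733170890,
    235243332593782820776961, 383926769033908080151817, 91431331030532914199909,
    10712232174922203608207, 113794768119706071568558, 416026501964859329094990,
    10997877484889828623439, 496409125200999322132714, 235308123346147856158085,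
    166988370480134366599433, 153891284934971700033699, 427411616562796449439148,
    124259831135948375568550, 51223654180139137409514, 234949599900806033771661,
    469228751518052342115593, 81695305413528752536676, 15867813276007605343439,
    491692632225746821293390, 193882496471588770185314, 546984022976049234319755,
    193882531408570742735939, 503486601576181579126155, 455762848081543484914084,
    163040590772345412944066, 343921327851965983956140, 417046841022399327154631,
    50919291918914291830246, 546625499257927366909293, 343635394320351899366535]⟩]

/-- The certificate for `K_18`. -/
def cert9 : Cert where
  n := 18
  pos := [0, 1, 2, 3, 4, 5, 6, 7, 8, 9, 10, 11, 12, 13, 14, 15, 16, 17]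
  base := 640068830579332777331723265
  scale := [1]
  types := [(1134979744801, 640068830579332777331723265), (69827855393,
    560357645531734600947141633), (3255862305, 557788828044849112840997889), (135300129,
    555370755263115551904435201), (2215674913, 560357569513224690746854401), (5276705,
    552952903335939591403277313), (102794273, 557788827970612286756817921), (197665,
    550535051696358835077843969), (4260897, 555370755263043055003962369), (3245089,
    557788827968219889041214465), (69272609, 560357569513152193846381569), (7201,
    548117200057129164816321537), (165921, 552952903335939520605522945), (134177,
    555370755263040718678068225), (3213345, 557788827970612215959063553)]
  gens := [(677384639668691746446151693, 677314862563549629978682529),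
    (677082591305831181257652260, 677341281463828165360237610)]
  classes := [
    ⟨[1], [328234443312508839806570666, 280521928503059212900115940, 550081478677510185953821775,
    285723445732541790777774537, 480098818157477209528800489, 545434594909186273654092936,
    284560377399737903919175789, 470509536176904257658697059, 162542714290167397836266921,
    6591539434218592880928145, 400381578189134296475903214, 594230797756039296966768004,
    323059570466589904907699273, 506588954483213925075132907, 127102916324645672050007306,
    350596984841931630475329711, 82667773033869504244007937, 580942508825468587941762384,
    360682807164682417936019715, 242063836584431634581067179, 212175158707074510145725571,
    235078563182052593667981418, 198311292564935931175439849, 235904822040149336832607308,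
    403119515281674672901693574, 324488540208379673895478273, 597870494451492564041535693,
    395403860958222008690589029, 326768949920529615499080807, 505796790376719728900325511,
    121244693464675554098189676, 155164434377632892752797808, 79126983872179606189852164,
    543281459588185648339754507, 272324798014109600741438982, 547777214048131958966819145,
    278214801859149557124213761, 315574513087970838368787949, 582142768421052720276219402,
    349619227093339090639361549, 122381837627733578097397761, 510441220470257639597876396,
    12590390606296574388907153, 57428817880494753790203432, 41299914078520000167264809,
    204399897373998993287199844, 250854474564406241628666221, 396649354133526672837161985,
    589403594600688969797740713, 365417176197689378571722084, 86215522012896360529347883,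
    556164039862598893078643170, 469567904142331786364786983, 271000500858426214282497232,
    553859214969931712995664045, 482977838149967491603210241, 282178479218309190061793612,
    549364082171819400385369348, 83840942347519145131787690, 355473857976801569025439205,
    591816870190321244733539399, 313340055832628773832370628, 286860748071881027952510027,
    473975901029539641677823434, 560357410039635785906564487, 273600969248166765710557603,
    481549285432494404343857410, 511607655510031950231535938, 17132969527878316861829425,
    389542409470127459212411076, 237064435822836642579197381, 352256976162713972437953770,
    88376954829641168358720744, 157653229783030436090528200, 18744632632486163467437137,
    397779289734145849908276707, 584565258171488929110831526, 325657361540937030401636677,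
    517502357625853936980344070, 133000924688375806203306223, 356786969744798753074755688,
    87540253065669917317219689, 596643271663029543326755950, 309871249243235779110640016,
    515194295320474677258959076, 123399436187788445547543880, 436651554879540583740094465,
    429251465948819678188551335, 441524159725318710840394178, 425702529135646495839860016,
    128604297779009766560412873, 164871224022393360152461474, 16101502331088336207614321,
    38991558754343438316414512, 51007793141055256577544748, 48372903982150349063597615,
    202437299912162982408434956, 249133544451260988213542025, 401370880424701068580000879,
    318363284179769553709307022, 287856720345130358801929610, 473037145977183374781197732,
    551630712045339561807587523, 282964501881163009919991086, 316858075866182389185610018,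
    586984405868966377801646306, 84629863306955497018770831, 161127521632183071808752910,
    465446163321232947638643215, 504236040320100824238232078, 310886741096942348503821836,
    388411252745753293808343560, 232616065956887331010390256, 353271199306408258462491022,
    92029754836605706924573902, 171913299564179403843044421, 2469961758251244640748017,
    49990165098242425563054626, 46319747184350197968058919, 205820922456222561937562059,
    435402526990003086159053902, 131817193768202923095402983, 169563670651775034628189485,
    8589148129701644050342097, 55780901163933939046292003, 208165511834590681052422567,
    434507856455756432426406275, 442939141434993523358377384, 118711218749078828219941259,
    513797650416438945804392815, 471678543208435678747594859, 276846831912859936046266511,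
    554992772249234680064457729, 477644147035786208088661158, 509350369895123568553077960,
    7571655514473086343777521, 393053522348903533630403015, 588181745732471375275237827,
    354710495919178077396468806, 245453531301718334827336168, 207220361042280348851124426,
    238620126134780218984276260, 194800436543500546588574210, 233743281033852042812132871,
    193548855074837883740718160, 54525036239539593560961572, 53470267832183660811040298,
    47612281386802300513750566, 9910083662145816120826993, 166959467664318278508455271,
    116603755552049201869794480, 364090340052076466076391425, 246819372940149121948327235,
    210636770175721300507897158, 428083709799895963918647565, 430383615267735808988585167,
    197069461075330271287972143, 247842194112738574469342479, 387322835145266462292480272,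
    5254894550167930899215697, 158756855649597345869861889, 475378222484920477942877325,
    521665107676719165613322345, 312069851804070660348920166, 404291799670576325254515883,
    595442359762540528165522792, 93403104948453665048380579, 348250966291176059696397744,
    585764895728771128115837195, 81346317558434658266924365, 165824830794958701145270662,
    134795277611628527808453038, 512743375398703421128248709, 321587297706097775468416431,
    289541620731152165830600965, 552801445260610988945936805, 468285744785936884120954053,
    516758578204367082611545379, 129664716094210433458143362, 361847938142931164880506316,
    90874199372437877941486855, 168051612282861736290398543, 3896410248835331636336913,
    391891530630706063961588130, 583349619025836333272023333, 320912106006527777405317323,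
    405610476915963122435759404, 590608925765796289127291020, 89735745531127825486103653,
    541883661059516486000062832, 275877627341838616784842920, 544452368364683222729539820,
    96111083198720409770182086, 358388773189308783186579783, 124709444267371331678938573,
    440596000268978964717148389, 209570952361444005822930312, 42804089340548650776403502,
    11335135918865755358434769, 173488021678338788163925227, 476863812763191303883326536,
    503254966158023938017697232, 314410786432648018504203491, 390787891944281283512252809,
    13457610580355299027364273, 52338225811842794947682853, 44817880834910334447140395,
    1295521074278199550295569, 156218476546892833297021443, 117765750617510165312221701,
    427144476542328256417931785, 431893693399742482986608748, 433139182969975061523935370,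
    437677648114189534170977766, 444294680816975436698422596, 196199247661653476485775361,
    44067954057691626675120685, 14849610829243998982813873, 520273193647416633365669889,
    466947802146706741667348814, 546832594166220494766908518, 274973005599026732061950306,
    557562146190448901590420778, 464268006713829422840068592, 508059970698821642309993546,
    130952643166801988105569348, 163258634652727122958064106, 94353288634970042316080620,
    362806965329480733462866059, 240884781122440940559347713, 203482051811416784513642733,
    244558891500437271509959042, 201135198144731175978248558, 243371965980083348298806446,
    366918619285497480339652802, 126146370864173163738609958, 170542953160522014435622092,
    77612220225450969488868496, 593019661506748496673709057, 394539569245034582043165773]⟩,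
    ⟨[1], [639834997420138310325638343, 639949474564269150155544740, 640068830579332777331723265,
    639912840448523252301765765, 640027621666693733209374818, 639715640810019557686419818,
    639679006694273659832640843, 639756849722658601808768265, 639523016563464134802683343,
    639990987550947835355595843, 639637493707594974632589740, 639600859591849076778810765,
    639559650679210032656462318, 639793483838404499662547240, 639871631535884208179417318]⟩]

theorem cert3_checkOrbits : cert3.checkOrbits = true := by
  decide +kernel

theorem cert3_checkPairs : cert3.checkPairs = true := by
  decide +kernel

theorem cert4_checkOrbits : cert4.checkOrbits = true := by
  decide +kernel

theorem cert4_checkPairs : cert4.checkPairs = true := by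
  decide +kernel

theorem cert5_checkOrbits : cert5.checkOrbits = true := by
  decide +kernel

theorem cert5_checkPairs : cert5.checkPairs = true := by
  decide +kernel

theorem cert6_checkOrbits : cert6.checkOrbits = true := by
  decide +kernel

theorem cert6_checkPairs : cert6.checkPairs = true := by
  decide +kernel

theorem cert7_checkOrbits : cert7.checkOrbits = true := by
  decide +kernel

theorem cert7_checkPairs : cert7.checkPairs = true := by
  decide +kernel

theorem cert8_checkOrbits : cert8.checkOrbits = true := by
  decide +kernel

theorem cert8_checkPairs : cert8.checkPairs = true := by
  decide +kernel

theorem cert9_checkOrbits : cert9.checkOrbits = true := by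
  decide +kernel

theorem cert9_checkPairs : cert9.checkPairs = true := by
  decide +kernel

/-- For every `3 ≤ k ≤ 9` there is a real symmetric matrix `M`, indexed by the perfect
matchings of `K_{2k}`, vanishing on every pair of matchings sharing at least two edges
(in particular on the diagonal), whose rows all sum to `(2k-1)(2k-3) - 1` and whose least
eigenvalue is `-1`. -/
theorem weighted_adjacency_small_k (k : ℕ) (hk3 : 3 ≤ k) (hk9 : k ≤ 9) :
    ∃ M : Matrix (PM (2 * k)) (PM (2 * k)) ℝ,
      M.IsSymm ∧
      (∀ P Q : PM (2 * k), 2 ≤ (P.1 ∩ Q.1).card → M P Q = 0) ∧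
      (∀ P : PM (2 * k), ∑ Q : PM (2 * k), M P Q = (2 * k - 1 : ℝ) * (2 * k - 3 : ℝ) - 1) ∧
      (∃ x : PM (2 * k) → ℝ, x ≠ 0 ∧ M.mulVec x = (-1 : ℝ) • x) ∧
      (∀ (μ : ℝ) (x : PM (2 * k) → ℝ), x ≠ 0 → M.mulVec x = μ • x → -1 ≤ μ) := by
  interval_cases k
  · exact Cert.exists_matrix cert3_checkOrbits cert3_checkPairs rfl (by norm_num) rfl
  · exact Cert.exists_matrix cert4_checkOrbits cert4_checkPairs rfl (by norm_num) rfl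
  · exact Cert.exists_matrix cert5_checkOrbits cert5_checkPairs rfl (by norm_num) rfl
  · exact Cert.exists_matrix cert6_checkOrbits cert6_checkPairs rfl (by norm_num) rfl
  · exact Cert.exists_matrix cert7_checkOrbits cert7_checkPairs rfl (by norm_num) rfl
  · exact Cert.exists_matrix cert8_checkOrbits cert8_checkPairs rfl (by norm_num) rfl
  · exact Cert.exists_matrix cert9_checkOrbits cert9_checkPairs rfl (by norm_num) rfl
end
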